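/- arXiv:1412.8011 — 2 statements merged into one kernel-verified Lean document; each statement's English description precedes it below -/
import Mathlib

section
/- Assume H satisfies the uniform convexity condition. There is a constant C, independent of δ ∈ (0,1), such that for every δ ∈ (0,1), every x ∈ ℝⁿ \ closure(Ω_δ), and every h ∈ ℝⁿ: u_δ(x + h) − 2u_δ(x) + u_δ(x − h) ≤ (C / dist(x, Ω_δ)) |h|². -/
open scoped RealInnerProductSpace
open Filter

/-- The Hessian matrix of `φ` at `x`, with entries the second derivatives in the
coordinate directions. -/
noncomputable def hessianMatrix {n : ℕ} (φ : EuclideanSpace ℝ (Fin n) → ℝ)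
    (x : EuclideanSpace ℝ (Fin n)) : Matrix (Fin n) (Fin n) ℝ :=
  Matrix.of fun i j =>
    iteratedFDeriv ℝ 2 φ x ![EuclideanSpace.single i (1 : ℝ), EuclideanSpace.single j (1 : ℝ)]

/-- `u` is a viscosity subsolution of `max {δu + F(D²u) - f, H(Du)} = 0` on `ℝⁿ`. -/
def IsSubsolutionDisc {n : ℕ} (F : Matrix (Fin n) (Fin n) ℝ → ℝ)
    (H f : EuclideanSpace ℝ (Fin n) → ℝ) (δ : ℝ)
    (u : EuclideanSpace ℝ (Fin n) → ℝ) : Prop :=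
  ∀ φ : EuclideanSpace ℝ (Fin n) → ℝ, ContDiff ℝ 2 φ →
    ∀ x₀, IsLocalMax (fun x => u x - φ x) x₀ →
      max (δ * u x₀ + F (hessianMatrix φ x₀) - f x₀) (H (gradient φ x₀)) ≤ 0

/-- `v` is a viscosity supersolution of `max {δv + F(D²v) - f, H(Dv)} = 0` on `ℝⁿ`. -/
def IsSupersolutionDisc {n : ℕ} (F : Matrix (Fin n) (Fin n) ℝ → ℝ)
    (H f : EuclideanSpace ℝ (Fin n) → ℝ) (δ : ℝ)
    (v : EuclideanSpace ℝ (Fin n) → ℝ) : Prop :=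
  ∀ φ : EuclideanSpace ℝ (Fin n) → ℝ, ContDiff ℝ 2 φ →
    ∀ x₀, IsLocalMin (fun x => v x - φ x) x₀ →
      0 ≤ max (δ * v x₀ + F (hessianMatrix φ x₀) - f x₀) (H (gradient φ x₀))

namespace SemiconcAux

theorem gradient_quad {E : Type*} [NormedAddCommGroup E] [InnerProductSpace ℝ E] [CompleteSpace E]
    (c : ℝ) (z x : E) : gradient (fun y => c * ‖y - z‖ ^ 2) x = (2 * c) • (x - z) := by
  apply HasGradientAt.gradient
  rw [hasGradientAt_iff_hasFDerivAt]
  have h := (((hasFDerivAt_id (𝕜 := ℝ) x).sub_const z).norm_sq).const_mul c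
  refine h.congr_fderiv ?_
  ext v
  simp [real_inner_smul_left]
  ring

theorem contDiff_quad {E : Type*} [NormedAddCommGroup E] [InnerProductSpace ℝ E] {k : WithTop ℕ∞}
    (c : ℝ) (z : E) : ContDiff ℝ k (fun y : E => c * ‖y - z‖ ^ 2) :=
  contDiff_const.mul ((contDiff_id.sub contDiff_const).norm_sq ℝ)

/-- A closed convex set is determined by its support function. -/
theorem mem_of_support {E : Type*} [NormedAddCommGroup E] [InnerProductSpace ℝ E] [CompleteSpace E]
    (K : Set E) (hc : Convex ℝ K) (hcl : IsClosed K) (ℓ : E → ℝ)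
    (hℓ : ∀ v, ∃ p ∈ K, ⟪p, v⟫ = ℓ v) (p : E) (hp : ∀ v, ⟪p, v⟫ ≤ ℓ v) : p ∈ K := by
  by_contra hn
  obtain ⟨g, s, h1, h2⟩ := geometric_hahn_banach_closed_point hc hcl hn
  set v := (InnerProductSpace.toDual ℝ E).symm g with hv
  have hg : ∀ y, g y = ⟪y, v⟫ := by
    intro y
    rw [real_inner_comm, hv, InnerProductSpace.toDual_symm_apply]
  obtain ⟨q, hq, hqv⟩ := hℓ v
  have := h1 q hq
  have h3 := hp v
  rw [hg] at this h2
  linarith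

/-- Sublinear bound functions give continuity. -/
theorem continuous_of_le {E : Type*} [NormedAddCommGroup E] (w : E → ℝ) (R : ℝ) (hR : 0 ≤ R)
    (hw : ∀ z z', w z - w z' ≤ R * ‖z - z'‖) : Continuous w := by
  have : LipschitzWith ⟨R, hR⟩ w := by
    apply LipschitzWith.of_dist_le_mul
    intro x y
    rw [Real.dist_eq, dist_eq_norm, abs_le]
    have h1 := hw x y
    have h2 := hw y x
    rw [norm_sub_rev] at h2
    change -(R * _) ≤ _ ∧ _ ≤ R * _
    constructor <;> linarith
  exact this.continuous

/-- A function whose supergradients lie in `K` grows at most like the support function. -/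
theorem sub_le_support {E : Type*} [NormedAddCommGroup E] [InnerProductSpace ℝ E]
    [FiniteDimensional ℝ E] (ℓ : E → ℝ) (R : ℝ) (hR : 0 ≤ R) (K : Set E)
    (hKR : ∀ p ∈ K, ‖p‖ ≤ R) (hK : ∀ p ∈ K, ∀ v, ⟪p, v⟫ ≤ ℓ v)
    (hhom : ∀ t : ℝ, 0 ≤ t → ∀ v, ℓ (t • v) = t * ℓ v)
    (u : E → ℝ) (hu : Continuous u) (A B : ℝ) (hA : 0 ≤ A) (hgr : ∀ x, u x ≤ A * ‖x‖ + B)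
    (hsub : ∀ (c : ℝ) (z a : E), 0 < c → (∀ y, u y - c * ‖y - z‖ ^ 2 ≤ u a - c * ‖a - z‖ ^ 2) →
      (2 * c) • (a - z) ∈ K) (x y : E) : u x - u y ≤ ℓ (x - y) := by
  -- existence of maximisers
  have hex : ∀ c : ℝ, 0 < c → ∀ z, ∃ a, ∀ y, u y - c * ‖y - z‖ ^ 2 ≤ u a - c * ‖a - z‖ ^ 2 := by
    intro c hc z
    have hcont : Continuous (fun y => u y - c * ‖y - z‖ ^ 2) := by fun_prop
    have hlim : Tendsto (fun y => u y - c * ‖y - z‖ ^ 2) (cocompact E) atBot := by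
      have h1 : Tendsto (fun y : E => ‖y - z‖) (cocompact E) atTop := by
        have := tendsto_norm_cocompact_atTop (E := E)
        refine tendsto_atTop_mono (f := fun y => ‖y‖ - ‖z‖) (fun y => norm_sub_norm_le y z) ?_
        exact tendsto_atTop_add_const_right _ _ this
      have h2 : Tendsto (fun t : ℝ => (A * ‖z‖ + B + (A + 1) ^ 2 / (4 * c)) + -t) atTop atBot :=
        tendsto_atBot_add_const_left _ _ tendsto_neg_atTop_atBot
      refine tendsto_atBot_mono ?_ (h2.comp h1)
      intro y
      have h3 := hgr y
      have h4 : ‖y‖ ≤ ‖y - z‖ + ‖z‖ := by simpa using norm_add_le (y - z) z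
      have h5 : A * ‖y‖ ≤ A * (‖y - z‖ + ‖z‖) := mul_le_mul_of_nonneg_left h4 hA
      have h6 : (A + 1) * ‖y - z‖ ≤ (A + 1) ^ 2 / (4 * c) + c * ‖y - z‖ ^ 2 := by
        have : (A + 1) ^ 2 / (4 * c) + c * ‖y - z‖ ^ 2 - (A + 1) * ‖y - z‖
            = (2 * c * ‖y - z‖ - (A + 1)) ^ 2 / (4 * c) := by field_simp; ring
        have h7 : 0 ≤ (2 * c * ‖y - z‖ - (A + 1)) ^ 2 / (4 * c) := by positivity
        linarith
      simp only [Function.comp]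
      nlinarith
    exact hcont.exists_forall_ge hlim
  -- the sup-convolution estimate
  have key : ∀ c : ℝ, 0 < c → ∃ a, ‖a - y‖ ≤ R / (2 * c) ∧ u x - u a ≤ ℓ (x - y) := by
    intro c hc
    choose a ha using hex c hc
    set S : E → ℝ := fun z => u (a z) - c * ‖a z - z‖ ^ 2 with hS
    have hp : ∀ z, (2 * c) • (a z - z) ∈ K := fun z => hsub c z (a z) hc (ha z)
    have hstep : ∀ z z', S z - S z' ≤ ℓ (z - z') + c * ‖z - z'‖ ^ 2 := by
      intro z z'
      have h1 := ha z' (a z)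
      have h2 := hK _ (hp z) (z - z')
      have h3 : ‖a z - z'‖ ^ 2 = ‖a z - z‖ ^ 2 + 2 * ⟪a z - z, z - z'⟫ + ‖z - z'‖ ^ 2 := by
        rw [← norm_add_sq_real]; simp
      rw [real_inner_smul_left] at h2
      simp only [hS]
      nlinarith
    have hN : ∀ N : ℕ, 0 < N → S x - S y ≤ ℓ (x - y) + c * ‖x - y‖ ^ 2 * (1 / (N : ℝ)) := by
      intro N hN
      have hN' : (0 : ℝ) < N := by exact_mod_cast hN
      have hind : ∀ k : ℕ, S (y + ((k : ℝ) / N) • (x - y)) - S y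
          ≤ (k : ℝ) * ((1 / N) * ℓ (x - y) + c * ((1 / N) ^ 2 * ‖x - y‖ ^ 2)) := by
        intro k
        induction k with
        | zero => simp
        | succ k ih =>
          have h1 := hstep (y + (((k + 1 : ℕ) : ℝ) / N) • (x - y)) (y + ((k : ℝ) / N) • (x - y))
          have h2 : (y + (((k + 1 : ℕ) : ℝ) / N) • (x - y)) - (y + ((k : ℝ) / N) • (x - y))
              = (1 / (N : ℝ)) • (x - y) := by
            rw [add_sub_add_left_eq_sub, ← sub_smul]
            congr 1
            push_cast
            ring
          rw [h2, hhom _ (by positivity), norm_smul, mul_pow, Real.norm_eq_abs, sq_abs] at h1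
          push_cast at *
          linarith
      have := hind N
      rw [div_self hN'.ne', one_smul] at this
      simp only [add_sub_cancel] at this
      refine this.trans (le_of_eq ?_)
      field_simp
    have hlim : S x - S y ≤ ℓ (x - y) := by
      have ht : Tendsto (fun N : ℕ => ℓ (x - y) + c * ‖x - y‖ ^ 2 * (1 / (N : ℝ))) atTop
          (nhds (ℓ (x - y) + c * ‖x - y‖ ^ 2 * 0)) :=
        (tendsto_one_div_atTop_nhds_zero_nat.const_mul _).const_add _
      rw [mul_zero, add_zero] at ht
      refine ge_of_tendsto ht ?_
      filter_upwards [eventually_gt_atTop 0] with N h using hN N h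
    refine ⟨a y, ?_, ?_⟩
    · have := hKR _ (hp y)
      rw [norm_smul, Real.norm_eq_abs, abs_of_pos (by positivity)] at this
      rw [le_div_iff₀ (by positivity)]
      linarith
    · have h1 := ha x x
      simp only [sub_self, norm_zero] at h1
      have h2 : 0 ≤ c * ‖a y - y‖ ^ 2 := by positivity
      simp only [hS] at hlim
      norm_num at h1
      linarith
  refine le_of_forall_pos_le_add ?_
  intro e he
  obtain ⟨d, hd, hd'⟩ := Metric.continuous_iff.1 hu y e he
  obtain ⟨a, ha1, ha2⟩ := key ((R + 1) / (2 * d)) (by positivity)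
  have : R / (2 * ((R + 1) / (2 * d))) < d := by
    have : R / (2 * ((R + 1) / (2 * d))) = d * (R / (R + 1)) := by field_simp
    rw [this]
    have h2 : R / (R + 1) < 1 := by rw [div_lt_one (by positivity)]; linarith
    nlinarith
  have h3 := hd' a (by rw [dist_eq_norm]; linarith)
  rw [Real.dist_eq, abs_lt] at h3
  linarith [h3.2]

/-- Comparison: if `w` is a subsolution, `u` a supersolution in a ball. -/
theorem comparison {E : Type*} [NormedAddCommGroup E] [InnerProductSpace ℝ E]
    [FiniteDimensional ℝ E] (H ℓ : E → ℝ) (R : ℝ) (hR : 0 ≤ R)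
    (hHconv : ConvexOn ℝ Set.univ H) (hH0 : H 0 < 0)
    (hsup : ∀ p, (∀ v, ⟪p, v⟫ ≤ ℓ v) → H p ≤ 0)
    (hℓR : ∀ v, ℓ v ≤ R * ‖v‖) (hhom : ∀ t : ℝ, 0 ≤ t → ∀ v, ℓ (t • v) = t * ℓ v)
    (u w : E → ℝ) (hu : Continuous u) (hw : ∀ z z', w z - w z' ≤ ℓ (z - z'))
    (x : E) (r : ℝ) (hr : 0 < r)
    (hvis : ∀ (c : ℝ) (a b : E), 0 < c → b ∈ Metric.ball x r →
      IsLocalMin (fun y => u y - (-c) * ‖y - a‖ ^ 2) b → 0 ≤ H ((2 * -c) • (b - a)))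
    (hbd : ∀ y ∈ Metric.sphere x r, w y ≤ u y) : w x ≤ u x := by
  by_contra hlt
  push Not at hlt
  set d := w x - u x with hd
  have hdpos : 0 < d := by linarith
  have hwc : Continuous w := continuous_of_le w R hR (fun z z' => (hw z z').trans (hℓR _))
  obtain ⟨M, hM⟩ := (isCompact_closedBall x r).exists_bound_of_continuousOn hwc.continuousOn
  have hM0 : 0 ≤ M := (norm_nonneg _).trans (hM x (Metric.mem_closedBall_self hr.le))
  obtain ⟨η, hη0, hη1, hηM⟩ : ∃ η : ℝ, 0 < η ∧ η < 1 ∧ η * M < d / 4 := by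
    refine ⟨d / (d + 4 * M + 4), by positivity, ?_, ?_⟩
    · rw [div_lt_one (by positivity)]; linarith
    · rw [div_mul_eq_mul_div, div_lt_iff₀ (by positivity)]; nlinarith
  -- penalisation parameter: c large
  obtain ⟨c, hc0, hcR, hcd⟩ : ∃ c : ℝ, 0 < c ∧ R < c ∧ R ^ 2 / (4 * c) < d / 4 := by
    refine ⟨R + R ^ 2 / d + 1, by positivity, ?_, ?_⟩
    · have : 0 ≤ R ^ 2 / d := by positivity
      linarith
    · have h1 : R ^ 2 = R ^ 2 / d * d := by field_simp
      have h2 : 0 ≤ R ^ 2 / d := by positivity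
      rw [div_lt_iff₀ (by positivity)]
      nlinarith
  have hl1 : 0 < 1 - η := by linarith
  set G : E × E → ℝ := fun q => (1 - η) * w q.1 - u q.2 - c * ‖q.2 - q.1‖ ^ 2 with hG
  have hGc : Continuous G := by fun_prop
  obtain ⟨⟨a, b⟩, hab, hmax⟩ := ((isCompact_closedBall x (r + 1)).prod
    (isCompact_closedBall x r)).exists_isMaxOn
      ⟨(x, x), Metric.mem_closedBall_self (by linarith), Metric.mem_closedBall_self hr.le⟩
      hGc.continuousOn
  obtain ⟨haB, hbB⟩ := hab
  simp only at haB hbB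
  have hmax' : ∀ a' ∈ Metric.closedBall x (r + 1), ∀ b' ∈ Metric.closedBall x r,
      (1 - η) * w a' - u b' - c * ‖b' - a'‖ ^ 2 ≤ (1 - η) * w a - u b - c * ‖b - a‖ ^ 2 :=
    fun a' ha' b' hb' => hmax (Set.mk_mem_prod ha' hb')
  have hwab : (1 - η) * w a ≤ (1 - η) * w b + R * ‖b - a‖ := by
    have h1 := (hw a b).trans (hℓR _)
    rw [norm_sub_rev] at h1
    have h2 : 0 ≤ R * ‖b - a‖ := by positivity
    nlinarith
  -- a is interior
  have hbB' : b ∈ Metric.closedBall x (r + 1) := Metric.closedBall_subset_closedBall (by linarith) hbB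
  have hba : ‖b - a‖ < 1 := by
    have h1 := hmax' b hbB' b hbB
    simp only [sub_self, norm_zero] at h1
    by_contra hge
    push Not at hge
    have : c * ‖b - a‖ ^ 2 ≤ R * ‖b - a‖ := by nlinarith
    have h2 : R * ‖b - a‖ < c * ‖b - a‖ := mul_lt_mul_of_pos_right hcR (by linarith)
    have h3 : c * ‖b - a‖ ≤ c * ‖b - a‖ ^ 2 := mul_le_mul_of_nonneg_left (by nlinarith) hc0.le
    linarith
  have haint : a ∈ Metric.ball x (r + 1) := by
    rw [Metric.mem_ball]
    rw [Metric.mem_closedBall] at hbB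
    have := dist_triangle a b x
    rw [dist_comm a b, dist_eq_norm b a] at this
    linarith
  -- b is interior
  have hbint : b ∈ Metric.ball x r := by
    by_contra hnb
    have hbs : b ∈ Metric.sphere x r := by
      rw [Metric.mem_sphere]
      rw [Metric.mem_ball, not_lt] at hnb
      exact le_antisymm hbB hnb
    have h1 := hbd b hbs
    have h2 := hM b hbB
    have h3 := hM x (Metric.mem_closedBall_self hr.le)
    rw [Real.norm_eq_abs, abs_le] at h2 h3
    have h4 := hmax' x (Metric.mem_closedBall_self (by linarith)) x
      (Metric.mem_closedBall_self hr.le)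
    simp only [sub_self, norm_zero] at h4
    have h5 : R * ‖b - a‖ ≤ R ^ 2 / (4 * c) + c * ‖b - a‖ ^ 2 := by
      have : R ^ 2 / (4 * c) + c * ‖b - a‖ ^ 2 - R * ‖b - a‖
          = (2 * c * ‖b - a‖ - R) ^ 2 / (4 * c) := by field_simp; ring
      have h7 : 0 ≤ (2 * c * ‖b - a‖ - R) ^ 2 / (4 * c) := by positivity
      linarith
    have h6 : η * w x ≤ η * M := mul_le_mul_of_nonneg_left h3.2 hη0.le
    have h7 : η * (-M) ≤ η * w b := mul_le_mul_of_nonneg_left h2.1 hη0.le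
    nlinarith
  -- supersolution at b
  have hHp : 0 ≤ H ((2 * -c) • (b - a)) := by
    refine hvis c a b hc0 hbint ?_
    filter_upwards [Metric.isOpen_ball.mem_nhds hbint] with y hy
    have := hmax' a haB y (Metric.ball_subset_closedBall hy)
    linarith
  set p := (2 * -c) • (b - a) with hp
  -- subsolution at a
  have hpv : ∀ v, ⟪p, v⟫ ≤ (1 - η) * ℓ v := by
    intro v
    have hev : ∀ᶠ t : ℝ in nhdsWithin 0 (Set.Ioi 0), ⟪p, v⟫ ≤ (1 - η) * ℓ v + c * ‖v‖ ^ 2 * t := by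
      have hcont : Continuous (fun t : ℝ => a - t • v) := by fun_prop
      have h1 : ∀ᶠ t : ℝ in nhds 0, a - t • v ∈ Metric.ball x (r + 1) := by
        apply hcont.continuousAt.eventually_mem
        simpa using Metric.isOpen_ball.mem_nhds haint
      filter_upwards [nhdsWithin_le_nhds h1, self_mem_nhdsWithin] with t ht htpos
      have htpos' : 0 < t := htpos
      have h2 := hmax' _ (Metric.ball_subset_closedBall ht) b hbB
      have h3 := hw a (a - t • v)
      rw [sub_sub_cancel, hhom t htpos'.le] at h3
      have h4 : ‖b - (a - t • v)‖ ^ 2 = ‖b - a‖ ^ 2 + 2 * (t * ⟪b - a, v⟫) + t ^ 2 * ‖v‖ ^ 2 := by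
        rw [show b - (a - t • v) = (b - a) + t • v by abel, norm_add_sq_real, real_inner_smul_right,
          norm_smul, mul_pow, Real.norm_eq_abs, sq_abs]
      have h5 : ⟪p, v⟫ = -2 * c * ⟪b - a, v⟫ := by
        rw [hp, real_inner_smul_left]; ring
      have h6 : (1 - η) * (w a - w (a - t • v)) ≤ (1 - η) * (t * ℓ v) :=
        mul_le_mul_of_nonneg_left h3 hl1.le
      rw [h4] at h2
      have h7 : t * ⟪p, v⟫ ≤ t * ((1 - η) * ℓ v + c * ‖v‖ ^ 2 * t) := by
        rw [h5]; nlinarith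
      exact le_of_mul_le_mul_left h7 htpos'
    have hlim : Tendsto (fun t : ℝ => (1 - η) * ℓ v + c * ‖v‖ ^ 2 * t) (nhdsWithin 0 (Set.Ioi 0))
        (nhds ((1 - η) * ℓ v)) := by
      have : Continuous (fun t : ℝ => (1 - η) * ℓ v + c * ‖v‖ ^ 2 * t) := by fun_prop
      have h := this.tendsto 0
      simp only [mul_zero, add_zero] at h
      exact h.mono_left nhdsWithin_le_nhds
    exact ge_of_tendsto hlim hev
  have hq : H ((1 - η)⁻¹ • p) ≤ 0 := by
    apply hsup
    intro v
    rw [real_inner_smul_left, inv_mul_le_iff₀ hl1]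
    exact hpv v
  have hcv := hHconv.2 (Set.mem_univ ((1 - η)⁻¹ • p)) (Set.mem_univ 0) hl1.le hη0.le (by ring)
  rw [smul_zero, add_zero, smul_smul, mul_inv_cancel₀ hl1.ne', one_smul] at hcv
  simp only [smul_eq_mul] at hcv
  nlinarith

/-- Uniform semiconcavity of the support function. -/
theorem support_semiconcave {E : Type*} [NormedAddCommGroup E] [InnerProductSpace ℝ E]
    [FiniteDimensional ℝ E] (H ℓ : E → ℝ) (hH : Continuous H) (R : ℝ) (hR : 0 ≤ R)
    (hKR : ∀ p, H p ≤ 0 → ‖p‖ ≤ R) (σ : ℝ) (hσ : 0 < σ)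
    (hHconv : ConvexOn ℝ Set.univ H)
    (hHsc : ConvexOn ℝ Set.univ fun p => H p - σ / 2 * ‖p‖ ^ 2)
    (hℓ : ∀ v, IsGreatest {r : ℝ | ∃ p, H p ≤ 0 ∧ ⟪p, v⟫ = r} (ℓ v)) :
    ∃ C : ℝ, 0 ≤ C ∧ ∀ v h : E, v ≠ 0 →
      ℓ (v + h) + ℓ (v - h) - 2 * ℓ v ≤ C / ‖v‖ * ‖h‖ ^ 2 := by
  obtain ⟨B₀, hB₀⟩ := (isCompact_closedBall (0 : E) (R + 1)).exists_bound_of_continuousOn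
    hH.continuousOn
  set B := max B₀ 0 with hB
  have hB0 : 0 ≤ B := le_max_right _ _
  have hHB : ∀ p, ‖p‖ ≤ R + 1 → H p ≤ B := fun p hp =>
    (le_abs_self _).trans ((hB₀ p (by simpa using hp)).trans (le_max_left _ _))
  obtain ⟨κ, hκ0, hκB, hκR⟩ : ∃ κ : ℝ, 0 < κ ∧ κ * B ≤ σ / 16 ∧ κ * (4 * R ^ 2) ≤ 1 / 2 := by
    refine ⟨1 / (16 * B / σ + 8 * R ^ 2 + 1), by positivity, ?_, ?_⟩
    · have h1 : 0 ≤ 16 * B / σ := by positivity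
      have h2 : B = σ / 16 * (16 * B / σ) := by field_simp
      rw [div_mul_eq_mul_div, div_le_iff₀ (by positivity)]
      nlinarith [sq_nonneg R]
    · have h1 : 0 ≤ 16 * B / σ := by positivity
      rw [div_mul_eq_mul_div, div_le_iff₀ (by positivity)]
      nlinarith [sq_nonneg R]
  -- strong convexity of K
  have hstrong : ∀ v p q : E, v ≠ 0 → H p ≤ 0 → ⟪p, v⟫ = ℓ v → H q ≤ 0 →
      ⟪q, v⟫ ≤ ⟪p, v⟫ - 2 * κ * ‖v‖ * ‖q - p‖ ^ 2 := by
    intro v p q hv hp hpv hq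
    have hvn : 0 < ‖v‖ := norm_pos_iff.2 hv
    set D := ‖q - p‖ with hD
    set m := (1 / 2 : ℝ) • p + (1 / 2 : ℝ) • q with hm
    have hpR := hKR p hp
    have hqR := hKR q hq
    have hmid : H m ≤ -(σ / 8) * D ^ 2 := by
      have h1 := hHsc.2 (Set.mem_univ p) (Set.mem_univ q)
        (show (0 : ℝ) ≤ 1 / 2 by norm_num) (show (0 : ℝ) ≤ 1 / 2 by norm_num) (by norm_num)
      rw [← hm] at h1
      have h2 : ‖m‖ ^ 2 = (1 / 2) * ‖p‖ ^ 2 + (1 / 2) * ‖q‖ ^ 2 - (1 / 4) * D ^ 2 := by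
        rw [hm, hD, norm_add_sq_real, norm_sub_sq_real, norm_smul, norm_smul, real_inner_smul_left,
          real_inner_smul_right, real_inner_comm p q]
        norm_num
        ring
      simp only [smul_eq_mul] at h1
      rw [h2] at h1
      nlinarith
    have hmR : ‖m‖ ≤ R := by
      refine (norm_add_le _ _).trans ?_
      rw [norm_smul, norm_smul]
      norm_num
      linarith
    have hDR : D ≤ 2 * R := (norm_sub_le _ _).trans (by linarith)
    have hD0 : 0 ≤ D := norm_nonneg _
    set e := (‖v‖)⁻¹ • v with he
    have hen : ‖e‖ = 1 := norm_smul_inv_norm (𝕜 := ℝ) hv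
    set s := κ * D ^ 2 with hs
    have hs0 : 0 ≤ s := by positivity
    have hs1 : s ≤ 1 / 2 := by
      have : D ^ 2 ≤ 4 * R ^ 2 := by nlinarith
      nlinarith
    have hme : H (m + e) ≤ B := by
      apply hHB
      refine (norm_add_le _ _).trans ?_
      rw [hen]; linarith
    have hin : H (m + s • e) ≤ 0 := by
      have h1 := hHconv.2 (Set.mem_univ m) (Set.mem_univ (m + e)) 
        (show 0 ≤ 1 - s by linarith) hs0 (by ring)
      rw [show (1 - s) • m + s • (m + e) = m + s • e by module] at h1
      simp only [smul_eq_mul] at h1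
      have h2 : s * H (m + e) ≤ s * B := mul_le_mul_of_nonneg_left hme hs0
      have h3 : s * B ≤ σ / 16 * D ^ 2 := by
        rw [hs]; nlinarith [sq_nonneg D]
      have h4 : (1 - s) * H m ≤ (1 - s) * (-(σ / 8) * D ^ 2) :=
        mul_le_mul_of_nonneg_left hmid (by linarith)
      have h5 : 0 ≤ σ * D ^ 2 := by positivity
      nlinarith
    have h6 := (hℓ v).2 ⟨m + s • e, hin, rfl⟩
    rw [← hpv, hm, he, inner_add_left, inner_add_left, real_inner_smul_left, real_inner_smul_left,
      real_inner_smul_left, real_inner_smul_left, real_inner_self_eq_norm_sq] at h6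
    have h7 : s * (‖v‖⁻¹ * ‖v‖ ^ 2) = κ * ‖v‖ * D ^ 2 := by
      rw [hs]; field_simp
    rw [h7] at h6
    linarith
  refine ⟨1 / (4 * κ), by positivity, ?_⟩
  intro v h hv
  have hvn : 0 < ‖v‖ := norm_pos_iff.2 hv
  obtain ⟨p, hp, hpv⟩ := (hℓ v).1
  have one : ∀ k : E, ℓ (v + k) ≤ ℓ v + ⟪p, k⟫ + ‖k‖ ^ 2 / (8 * κ * ‖v‖) := by
    intro k
    obtain ⟨q, hq, hqv⟩ := (hℓ (v + k)).1
    have h1 := hstrong v p q hv hp hpv hq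
    have h2 : ⟪q - p, k⟫ ≤ ‖q - p‖ * ‖k‖ := real_inner_le_norm _ _
    rw [inner_sub_left] at h2
    rw [inner_add_right] at hqv
    have h3 : ‖q - p‖ * ‖k‖ ≤ ‖k‖ ^ 2 / (8 * κ * ‖v‖) + 2 * κ * ‖v‖ * ‖q - p‖ ^ 2 := by
      have : ‖k‖ ^ 2 / (8 * κ * ‖v‖) + 2 * κ * ‖v‖ * ‖q - p‖ ^ 2 - ‖q - p‖ * ‖k‖
          = (4 * κ * ‖v‖ * ‖q - p‖ - ‖k‖) ^ 2 / (8 * κ * ‖v‖) := by field_simp; ring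
      have h7 : 0 ≤ (4 * κ * ‖v‖ * ‖q - p‖ - ‖k‖) ^ 2 / (8 * κ * ‖v‖) := by positivity
      linarith
    linarith
  have h1 := one h
  have h2 := one (-h)
  rw [inner_neg_right, norm_neg, ← sub_eq_add_neg] at h2
  have h3 : 1 / (4 * κ) / ‖v‖ * ‖h‖ ^ 2
      = ‖h‖ ^ 2 / (8 * κ * ‖v‖) + ‖h‖ ^ 2 / (8 * κ * ‖v‖) := by field_simp; ring
  rw [h3]
  linarith

end SemiconcAux

/-- Under uniform convexity of `H`, there is `C`, independent of
`δ ∈ (0,1)`, such that for the solution `u_δ` of the discounted problem and every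
`x ∉ closure Ω_δ` and every `h`:
`u_δ(x+h) - 2u_δ(x) + u_δ(x-h) ≤ (C / dist(x, Ω_δ)) |h|²`. -/
theorem semiconcavity_away_from_contact_set
    {n : ℕ} (hn : 0 < n)
    (θ Θ : ℝ) (hθ : 0 ≤ θ) (hθΘ : θ ≤ Θ)
    (F : Matrix (Fin n) (Fin n) ℝ → ℝ)
    (hFell : ∀ M N : Matrix (Fin n) (Fin n) ℝ, M.IsSymm → N.PosSemidef →
      -Θ * N.trace ≤ F (M + N) - F M ∧ F (M + N) - F M ≤ -θ * N.trace)
    (hFhom : ∀ t : ℝ, 0 ≤ t → ∀ M : Matrix (Fin n) (Fin n) ℝ, M.IsSymm →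
      F (t • M) = t * F M)
    (hFsadd : ∀ M N : Matrix (Fin n) (Fin n) ℝ, M.IsSymm → N.IsSymm →
      F M + F N ≤ F (M + N))
    (H ℓ : EuclideanSpace ℝ (Fin n) → ℝ)
    (hH : Continuous H) (hH0 : H 0 < 0)
    (hKcpt : IsCompact {p : EuclideanSpace ℝ (Fin n) | H p ≤ 0})
    (hKconv : StrictConvex ℝ {p : EuclideanSpace ℝ (Fin n) | H p ≤ 0})
    (hHconv : ConvexOn ℝ Set.univ H)
    (σ Sig : ℝ) (hσ : 0 < σ) (hSig : 0 < Sig)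
    (hHsc : ConvexOn ℝ Set.univ fun p => H p - σ / 2 * ‖p‖ ^ 2)
    (hHSc : ConvexOn ℝ Set.univ fun p => Sig / 2 * ‖p‖ ^ 2 - H p)
    (hℓ : ∀ v, IsGreatest {r : ℝ | ∃ p, H p ≤ 0 ∧ ⟪p, v⟫ = r} (ℓ v))
    (f : EuclideanSpace ℝ (Fin n) → ℝ)
    (hf : ConvexOn ℝ Set.univ f)
    (hfsl : Tendsto (fun x => f x / ‖x‖) (cocompact (EuclideanSpace ℝ (Fin n))) atTop) :
    ∃ C : ℝ, ∀ δ ∈ Set.Ioo (0 : ℝ) 1,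
      ∀ u : EuclideanSpace ℝ (Fin n) → ℝ, Continuous u →
        IsSubsolutionDisc F H f δ u → IsSupersolutionDisc F H f δ u →
        Tendsto (fun x => u x / ℓ x) (cocompact (EuclideanSpace ℝ (Fin n))) (nhds 1) →
        ∀ Ω : Set (EuclideanSpace ℝ (Fin n)),
          Ω = {x | ¬ ∀ φ : EuclideanSpace ℝ (Fin n) → ℝ, ContDiff ℝ 1 φ →
            IsLocalMin (fun y => u y - φ y) x → 0 ≤ H (gradient φ x)} →
          ∀ x ∉ closure Ω, ∀ h : EuclideanSpace ℝ (Fin n),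
            u (x + h) - 2 * u x + u (x - h) ≤ C / Metric.infDist x Ω * ‖h‖ ^ 2 := by
  classical
  obtain ⟨R₀, hR₀⟩ := hKcpt.isBounded.exists_norm_le
  have hKR : ∀ p, H p ≤ 0 → ‖p‖ ≤ R₀ := fun p hp => hR₀ p hp
  have hR : 0 ≤ R₀ := (norm_nonneg _).trans (hKR 0 hH0.le)
  have hKl : ∀ p, H p ≤ 0 → ∀ v, ⟪p, v⟫ ≤ ℓ v := fun p hp v => (hℓ v).2 ⟨p, hp, rfl⟩
  have hatt : ∀ v, ∃ p, H p ≤ 0 ∧ ⟪p, v⟫ = ℓ v := fun v => (hℓ v).1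
  have hℓ0 : ∀ v, 0 ≤ ℓ v := fun v => by simpa using hKl 0 hH0.le v
  have hℓR : ∀ v, ℓ v ≤ R₀ * ‖v‖ := by
    intro v
    obtain ⟨p, hp, hpv⟩ := hatt v
    rw [← hpv]
    exact (real_inner_le_norm p v).trans
      (mul_le_mul_of_nonneg_right (hKR p hp) (norm_nonneg _))
  have hhom : ∀ t : ℝ, 0 ≤ t → ∀ v, ℓ (t • v) = t * ℓ v := by
    intro t ht v
    apply le_antisymm
    · obtain ⟨p, hp, hpv⟩ := hatt (t • v)
      rw [← hpv, real_inner_smul_right]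
      exact mul_le_mul_of_nonneg_left (hKl p hp v) ht
    · obtain ⟨p, hp, hpv⟩ := hatt v
      rw [← hpv, ← real_inner_smul_right]
      exact hKl p hp _
  have hadd : ∀ v v', ℓ (v + v') ≤ ℓ v + ℓ v' := by
    intro v v'
    obtain ⟨p, hp, hpv⟩ := hatt (v + v')
    rw [← hpv, inner_add_right]
    exact add_le_add (hKl p hp v) (hKl p hp v')
  have hsup : ∀ p, (∀ v, ⟪p, v⟫ ≤ ℓ v) → H p ≤ 0 := fun p hp =>
    SemiconcAux.mem_of_support {p | H p ≤ 0} hKconv.convex hKcpt.isClosed ℓ hatt p hp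
  have hℓc : Continuous ℓ := SemiconcAux.continuous_of_le ℓ R₀ hR (fun z z' => by
    have h1 := hadd (z - z') z'
    rw [sub_add_cancel] at h1
    linarith [hℓR (z - z')])
  obtain ⟨C, hC0, hC⟩ := SemiconcAux.support_semiconcave H ℓ hH R₀ hR hKR σ hσ hHconv hHsc hℓ
  refine ⟨C, ?_⟩
  intro δ _ u hu hsub _ hlim Ω hΩ x hx h
  -- linear growth
  obtain ⟨B, hB⟩ : ∃ B, ∀ x, u x ≤ 2 * R₀ * ‖x‖ + B := by
    have h1 : ∀ᶠ x in cocompact (EuclideanSpace ℝ (Fin n)), u x / ℓ x ∈ Set.Ioo (1 / 2 : ℝ) 2 :=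
      hlim.eventually_mem (Ioo_mem_nhds (by norm_num) (by norm_num))
    rw [Filter.Eventually, Filter.mem_cocompact] at h1
    obtain ⟨S, hS, hS'⟩ := h1
    obtain ⟨B, hB⟩ := hS.exists_bound_of_continuousOn hu.continuousOn
    refine ⟨max B 0, fun x => ?_⟩
    by_cases hxS : x ∈ S
    · have h2 := (le_abs_self _).trans (hB x hxS)
      have h3 := le_max_left B 0
      have : 0 ≤ 2 * R₀ * ‖x‖ := by positivity
      linarith
    · have h2 := hS' hxS
      simp only [Set.mem_ofPred_eq, Set.mem_Ioo] at h2
      have h3 : ℓ x ≠ 0 := by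
        intro h0
        rw [h0, div_zero] at h2
        linarith [h2.1]
      have h4 : 0 < ℓ x := lt_of_le_of_ne (hℓ0 x) (Ne.symm h3)
      have h5 := (div_lt_iff₀ h4).1 h2.2
      have h6 := le_max_right B 0
      linarith [hℓR x]
  have huℓ : ∀ a b, u a - u b ≤ ℓ (a - b) := by
    refine SemiconcAux.sub_le_support ℓ R₀ hR {p | H p ≤ 0} hKR hKl hhom u hu (2 * R₀) B
      (by positivity) hB ?_
    intro c z a _ hmax
    have h1 := hsub _ (SemiconcAux.contDiff_quad c z) a (Filter.Eventually.of_forall hmax)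
    rw [SemiconcAux.gradient_quad] at h1
    exact (le_max_right _ _).trans h1
  -- main estimate on balls disjoint from Ω
  have hball : ∀ r : ℝ, 0 < r → (∀ b ∈ Metric.ball x r, b ∉ Ω) →
      u (x + h) - 2 * u x + u (x - h) ≤ C / r * ‖h‖ ^ 2 := by
    intro r hr hrΩ
    haveI : Nonempty (Fin n) := ⟨⟨0, hn⟩⟩
    haveI : Nontrivial (EuclideanSpace ℝ (Fin n)) := inferInstance
    have hne : (Metric.sphere x r).Nonempty := NormedSpace.sphere_nonempty.2 hr.le
    have hexY : ∀ z, ∃ y ∈ Metric.sphere x r, ∀ y' ∈ Metric.sphere x r,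
        u y + ℓ (z - y) ≤ u y' + ℓ (z - y') := by
      intro z
      have hc : Continuous (fun y => u y + ℓ (z - y)) := by fun_prop
      exact (isCompact_sphere x r).exists_isMinOn hne hc.continuousOn
    choose Y hYs hY using hexY
    have hcomp := SemiconcAux.comparison H ℓ R₀ hR hHconv hH0 hsup hℓR hhom u
      (fun z => u (Y z) + ℓ (z - Y z)) hu ?_ x r hr ?_ ?_
    · have hyn : ‖x - Y x‖ = r := by
        have := hYs x
        rw [Metric.mem_sphere, dist_comm, dist_eq_norm] at this
        exact this
      have hv : x - Y x ≠ 0 := by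
        rw [← norm_pos_iff, hyn]; exact hr
      have h1 := hC (x - Y x) h hv
      have h2 := huℓ (x + h) (Y x)
      have h3 := huℓ (x - h) (Y x)
      rw [show x + h - Y x = x - Y x + h by abel] at h2
      rw [show x - h - Y x = x - Y x - h by abel] at h3
      rw [hyn] at h1
      linarith
    · intro z z'
      have h1 := hY z (Y z') (hYs z')
      have h2 := hadd (z - z') (z' - Y z')
      rw [sub_add_sub_cancel] at h2
      linarith
    · intro c a b _ hb hmin
      have h1 := hrΩ b hb
      rw [hΩ] at h1
      simp only [Set.mem_ofPred_eq, not_not] at h1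
      have h2 := h1 _ (SemiconcAux.contDiff_quad (-c) a) hmin
      rwa [SemiconcAux.gradient_quad] at h2
    · intro y hy
      have h1 := hY y y hy
      have h2 := hℓR 0
      rw [sub_self] at h1
      rw [norm_zero, mul_zero] at h2
      linarith
  rcases Ω.eq_empty_or_nonempty with hemp | hnon
  · have hle : ∀ᶠ r : ℝ in atTop, u (x + h) - 2 * u x + u (x - h) ≤ C / r * ‖h‖ ^ 2 := by
      filter_upwards [eventually_gt_atTop 0] with r hr
      exact hball r hr (fun b _ => by rw [hemp]; exact Set.notMem_empty b)
    have ht : Tendsto (fun r : ℝ => C / r * ‖h‖ ^ 2) atTop (nhds (0 * ‖h‖ ^ 2)) :=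
      (tendsto_const_nhds.div_atTop tendsto_id).mul_const _
    have h1 := ge_of_tendsto ht hle
    rw [hemp, Metric.infDist_empty, div_zero]
    exact h1
  · have hpos : 0 < Metric.infDist x Ω := by
      refine lt_of_le_of_ne Metric.infDist_nonneg (fun h0 => hx ?_)
      exact (Metric.mem_closure_iff_infDist_zero hnon).2 h0.symm
    refine hball _ hpos ?_
    intro b hb hbΩ
    have h1 := Metric.infDist_le_dist_of_mem (x := x) hbΩ
    rw [Metric.mem_ball, dist_comm] at hb
    linarith
end

section
/- Assume in addition that F is uniformly elliptic (θ > 0) and that H satisfies the uniform convexity condition. Then there exists a constant C, independent of δ, such that for every δ ∈ (0,1) and all x, h ∈ ℝⁿ: 0 ≤ u_δ(x + h) − 2u_δ(x) + u_δ(x − h) ≤ C|h|²; equivalently, D²u_δ ∈ L^∞(ℝⁿ; Sₙ(ℝ)) with ‖D²u_δ‖_{L^∞} ≤ C for all δ ∈ (0,1). -/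
open scoped RealInnerProductSpace
open Filter

open scoped RealInnerProductSpace
open Filter

section Alexandrov
set_option linter.unusedSectionVars false
variable {V : Type*} [NormedAddCommGroup V] [InnerProductSpace ℝ V] [FiniteDimensional ℝ V]

theorem exists_subgrad {g : V → ℝ} (hg : ConvexOn ℝ Set.univ g) (x : V) :
    ∃ q : V, ∀ y, g x + ⟪q, y - x⟫ ≤ g y := by
  have hgc : Continuous g := hg.locallyLipschitz.continuous
  have hconv : Convex ℝ {p : V × ℝ | p.1 ∈ Set.univ ∧ g p.1 < p.2} := hg.convex_strict_epigraph
  have hopen : IsOpen {p : V × ℝ | p.1 ∈ Set.univ ∧ g p.1 < p.2} := by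
    simp only [Set.mem_univ, true_and]
    exact isOpen_lt (hgc.comp continuous_fst) continuous_snd
  have hnot : (x, g x) ∉ {p : V × ℝ | p.1 ∈ Set.univ ∧ g p.1 < p.2} := by simp
  obtain ⟨L, hL⟩ := geometric_hahn_banach_open_point hconv hopen hnot
  have hL' : ∀ (z : V) (s : ℝ), g z < s → L (z, 0) + s * L (0, 1) < L (x, 0) + g x * L (0, 1) := by
    intro z s hs
    have h1 := hL (z, s) ⟨Set.mem_univ _, hs⟩
    have e : ∀ (z : V) (s : ℝ), L (z, s) = L (z, 0) + s * L (0, 1) := by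
      intro z s
      have : ((z, s) : V × ℝ) = (z, 0) + s • (0, 1) := by simp
      rw [this, map_add, map_smul, smul_eq_mul]
    rwa [e z s, e x (g x)] at h1
  have hneg : L (0, 1) < 0 := by
    have := hL' x (g x + 1) (by linarith)
    nlinarith
  set a := L (0, 1) with ha
  let l : V →L[ℝ] ℝ := L.comp (ContinuousLinearMap.inl ℝ V ℝ)
  refine ⟨(InnerProductSpace.toDual ℝ V).symm ((-a)⁻¹ • l), fun y => ?_⟩
  rw [InnerProductSpace.toDual_symm_apply]
  have hly : ∀ z, l z = L (z, 0) := fun z => by simp [l]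
  simp only [smul_apply, map_sub, smul_eq_mul, hly]
  have hle : L (y, 0) + g y * a ≤ L (x, 0) + g x * a := by
    by_contra hc
    push Not at hc
    set d := L (y, 0) + g y * a - (L (x, 0) + g x * a) with hd
    have hdpos : 0 < d := by linarith
    have := hL' y (g y + d / (-2 * a)) (by
      have : 0 < d / (-2 * a) := div_pos hdpos (by linarith)
      linarith)
    have hane : a ≠ 0 := hneg.ne
    have e2 : d / (-2 * a) * a = - d / 2 := by field_simp
    nlinarith
  have : (-a)⁻¹ * (L (y, 0) - L (x, 0)) ≤ (-a)⁻¹ * ((g y - g x) * (-a)) := by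
    apply mul_le_mul_of_nonneg_left _ (inv_nonneg.2 (by linarith))
    linarith
  have e3 : (-a)⁻¹ * ((g y - g x) * (-a)) = g y - g x := by
    have : a ≠ 0 := hneg.ne
    field_simp
  linarith

theorem ev_cocompact (y : V) (R : ℝ) : ∀ᶠ x in cocompact V, R < ‖x - y‖ := by
  have := (isCompact_closedBall y R).compl_mem_cocompact
  filter_upwards [this] with x hx
  simpa [dist_eq_norm] using hx

theorem exists_prox {g : V → ℝ} (hg : ConvexOn ℝ Set.univ g) (y : V) :
    ∃ x : V, ∀ z, g x + ⟪y - x, z - x⟫ ≤ g z := by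
  have hgc : Continuous g := hg.locallyLipschitz.continuous
  obtain ⟨q, hq⟩ := exists_subgrad hg y
  have hk : Continuous (fun x => g x + 1 / 2 * ‖x - y‖ ^ 2) := by fun_prop
  obtain ⟨x, hx⟩ := hk.exists_forall_le' y (by
    filter_upwards [ev_cocompact y (2 * ‖q‖)] with x hx
    have h1 := hq x
    have h2 : -(‖q‖ * ‖x - y‖) ≤ ⟪q, x - y⟫ := by
      have := abs_real_inner_le_norm q (x - y)
      exact (abs_le.1 this).1
    simp only [sub_self, norm_zero]
    nlinarith [norm_nonneg q, norm_nonneg (x - y)])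
  refine ⟨x, fun z => ?_⟩
  have key : ∀ t : ℝ, 0 < t → t ≤ 1 → g x + ⟪y - x, z - x⟫ - t / 2 * ‖z - x‖ ^ 2 ≤ g z := by
    intro t ht ht1
    have h1 := hx (x + t • (z - x))
    have h2 := hg.2 (Set.mem_univ x) (Set.mem_univ z) (by linarith : 0 ≤ 1 - t) ht.le (by ring)
    have e1 : (1 - t) • x + t • z = x + t • (z - x) := by module
    rw [e1] at h2
    have e2 : ‖x + t • (z - x) - y‖ ^ 2 = ‖x - y‖ ^ 2 - 2 * t * ⟪y - x, z - x⟫ + t ^ 2 * ‖z - x‖ ^ 2 := by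
      have : x + t • (z - x) - y = (x - y) + t • (z - x) := by module
      rw [this, norm_add_sq_real, inner_smul_right, norm_smul, mul_pow, Real.norm_eq_abs, sq_abs,
        ← neg_sub y x, inner_neg_left, norm_neg]
      ring
    simp only [e2, smul_eq_mul] at h1 h2
    have : t * (g x + ⟪y - x, z - x⟫ - t / 2 * ‖z - x‖ ^ 2) ≤ t * g z := by nlinarith
    exact le_of_mul_le_mul_left this ht
  apply le_of_forall_pos_le_add
  intro e he
  have hp : 0 < ‖z - x‖ ^ 2 + 1 := by positivity
  have := key (min 1 (e / (‖z - x‖ ^ 2 + 1))) (by positivity) (min_le_left _ _)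
  have h3 : min 1 (e / (‖z - x‖ ^ 2 + 1)) * (‖z - x‖ ^ 2 + 1) ≤ e := by
    calc _ ≤ (e / (‖z - x‖ ^ 2 + 1)) * (‖z - x‖ ^ 2 + 1) := by gcongr; exact min_le_right _ _
      _ = e := by field_simp
  have h4 : 0 < min 1 (e / (‖z - x‖ ^ 2 + 1)) := by positivity
  nlinarith

theorem subgrad_firm {g : V → ℝ} {x₁ x₂ q₁ q₂ : V} (h₁ : ∀ z, g x₁ + ⟪q₁, z - x₁⟫ ≤ g z)
    (h₂ : ∀ z, g x₂ + ⟪q₂, z - x₂⟫ ≤ g z) :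
    ‖x₁ - x₂‖ ^ 2 ≤ ⟪x₁ - x₂, (x₁ + q₁) - (x₂ + q₂)⟫ := by
  have a := h₁ x₂
  have b := h₂ x₁
  have e : (x₁ + q₁) - (x₂ + q₂) = (x₁ - x₂) + (q₁ - q₂) := by abel
  rw [e, inner_add_right, real_inner_self_eq_norm_sq, real_inner_comm, inner_sub_left]
  rw [← neg_sub x₁ x₂, inner_neg_right] at a
  linarith

theorem telescoping {k : ℝ → ℝ} {b e : ℝ}
    (h : ∀ s t, 0 ≤ s → s ≤ t → t ≤ 1 → k t - k s ≤ (t - s) ^ 2 * b + (t - s) * e) :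
    k 1 - k 0 ≤ e := by
  have h1 : ∀ N : ℕ, 0 < N → k 1 - k 0 ≤ b / N + e := by
    intro N hN
    have hN' : (0 : ℝ) < N := by exact_mod_cast hN
    have h2 : ∀ i : ℕ, i ≤ N → k (i / N) - k 0 ≤ i * ((1 / N) ^ 2 * b + 1 / N * e) := by
      intro i
      induction i with
      | zero => intro _; simp
      | succ i ih =>
        intro hi
        have h3 := ih (by omega)
        have hi' : ((i : ℝ) + 1) ≤ N := by exact_mod_cast hi
        have h4 := h (i / N) ((i + 1 : ℕ) / N) (by positivity)
          (by gcongr; simp) (by rw [div_le_one hN']; exact_mod_cast hi)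
        have e1 : ((i + 1 : ℕ) : ℝ) / N - i / N = 1 / N := by push_cast; field_simp; ring
        rw [e1] at h4
        push_cast at h4 ⊢
        linarith
    have h5 := h2 N le_rfl
    rw [div_self hN'.ne'] at h5
    have e2 : (N : ℝ) * ((1 / N) ^ 2 * b + 1 / N * e) = b / N + e := by field_simp
    linarith
  have h2 : Tendsto (fun N : ℕ => b / N + e) atTop (nhds (0 + e)) :=
    (tendsto_const_div_atTop_nhds_zero_nat b).add tendsto_const_nhds
  rw [zero_add] at h2
  exact ge_of_tendsto h2 (by filter_upwards [eventually_gt_atTop 0] with N hN using h1 N hN)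

/-- second-order expansion -/
def Twice (g : V → ℝ) (x p : V) (B : V →L[ℝ] V) : Prop :=
  ∀ η > 0, ∀ᶠ y in nhds x, |g y - g x - ⟪p, y - x⟫ - 1 / 2 * ⟪B (y - x), y - x⟫| ≤ η * ‖y - x‖ ^ 2

theorem twice_of_prox {g : V → ℝ} (hg : ConvexOn ℝ Set.univ g) {J : V → V}
    (hJ : ∀ y z, g (J y) + ⟪y - J y, z - J y⟫ ≤ g z) {y : V} {T : V →L[ℝ] V}
    (hT : HasFDerivAt J T y) (hdet : T.det ≠ 0) :
    ∃ B, Twice g (J y) (y - J y) B := by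
  let Te := T.toContinuousLinearEquivOfDetNeZero hdet
  let S : V →L[ℝ] V := Te.symm
  have hST : ∀ v, S (T v) = v := fun v => Te.symm_apply_apply v
  refine ⟨S - ContinuousLinearMap.id ℝ V, ?_⟩
  have hfirm : ∀ y₁ y₂, ‖J y₁ - J y₂‖ ^ 2 ≤ ⟪J y₁ - J y₂, y₁ - y₂⟫ := by
    intro y₁ y₂
    have := subgrad_firm (hJ y₁) (hJ y₂)
    simpa using this
  have hJu : ∀ x q, (∀ z, g x + ⟪q, z - x⟫ ≤ g z) → J (x + q) = x := by
    intro x q hq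
    have := subgrad_firm (hJ (x + q)) hq
    simp only [add_sub_cancel, sub_self, inner_zero_right] at this
    have h0 : ‖J (x + q) - x‖ = 0 := by
      have := norm_nonneg (J (x + q) - x); nlinarith
    rwa [norm_eq_zero, sub_eq_zero] at h0
  set c : ℝ := 1 / (2 * (‖S‖ + 1)) with hc
  have hSn : 0 ≤ ‖S‖ := norm_nonneg _
  have hcpos : 0 < c := by positivity
  have hTlow : ∀ v, 2 * c * ‖v‖ ≤ ‖T v‖ := by
    intro v
    have h1 : ‖v‖ ≤ ‖S‖ * ‖T v‖ := by
      calc ‖v‖ = ‖S (T v)‖ := by rw [hST]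
        _ ≤ _ := S.le_opNorm _
    have h2 : ‖v‖ ≤ (‖S‖ + 1) * ‖T v‖ := by nlinarith [norm_nonneg (T v)]
    have h3 : 2 * c * (‖S‖ + 1) = 1 := by rw [hc]; field_simp
    have : 2 * c * ‖v‖ ≤ 2 * c * ((‖S‖ + 1) * ‖T v‖) := by gcongr
    calc _ ≤ _ := this
      _ = (2 * c * (‖S‖ + 1)) * ‖T v‖ := by ring
      _ = _ := by rw [h3, one_mul]
  -- derivative of the subgradient
  have hsub : ∀ η > 0, ∃ ρ > 0, ∀ x' q', ‖x' - J y‖ < ρ → (∀ z, g x' + ⟪q', z - x'⟫ ≤ g z) →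
      ‖q' - (y - J y) - (S - ContinuousLinearMap.id ℝ V) (x' - J y)‖ ≤ η * ‖x' - J y‖ := by
    intro η hη
    set κ := min c (η * c / (‖S‖ + 1)) with hκ
    have hκpos : 0 < κ := by positivity
    have hd := hT.isLittleO.def hκpos
    rw [Metric.eventually_nhds_iff] at hd
    obtain ⟨r', hr', hd⟩ := hd
    set r := r' / 2 with hr
    have hrpos : 0 < r := by positivity
    have hd' : ∀ y', ‖y' - y‖ ≤ r → ‖J y' - J y - T (y' - y)‖ ≤ κ * ‖y' - y‖ := by
      intro y' h
      exact hd (by rw [dist_eq_norm]; linarith)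
    have hlow : ∀ y', ‖y' - y‖ ≤ r → c * ‖y' - y‖ ≤ ‖J y' - J y‖ := by
      intro y' h
      have h1 := hd' y' h
      have h2 := hTlow (y' - y)
      have h3 : ‖T (y' - y)‖ ≤ ‖J y' - J y‖ + ‖J y' - J y - T (y' - y)‖ := by
        have := norm_sub_le (J y' - J y) (J y' - J y - T (y' - y))
        simpa using this
      have h4 : κ * ‖y' - y‖ ≤ c * ‖y' - y‖ := by gcongr; exact min_le_left _ _
      linarith
    refine ⟨c ^ 2 * r, by positivity, fun x' q' hx' hq' => ?_⟩
    have hJy : J (x' + q') = x' := hJu x' q' hq'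
    set y' := x' + q' with hy'
    have hclose : ‖y' - y‖ ≤ r := by
      by_contra hfar
      push Not at hfar
      set s := r / ‖y' - y‖ with hs
      have hn : 0 < ‖y' - y‖ := by linarith
      have hs1 : s < 1 := by rw [hs, div_lt_one hn]; exact hfar
      have hspos : 0 < s := by positivity
      set y2 := y + s • (y' - y) with hy2
      have e1 : y2 - y = s • (y' - y) := by rw [hy2]; abel
      have n1 : ‖y2 - y‖ = r := by
        rw [e1, norm_smul, Real.norm_of_nonneg hspos.le, hs]; field_simp
      have f1 := hfirm y2 y
      have f2 := hfirm y' y2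
      have e2 : y' - y2 = (1 - s) • (y' - y) := by rw [hy2]; module
      rw [e1, inner_smul_right] at f1
      rw [e2, inner_smul_right] at f2
      have g1 : 0 ≤ ⟪J y' - J y2, y' - y⟫ := by
        have : 0 ≤ (1 - s) * ⟪J y' - J y2, y' - y⟫ := le_trans (by positivity) f2
        exact nonneg_of_mul_nonneg_right this (by linarith)
      have g2 : ⟪J y' - J y, y' - y⟫ = ⟪J y' - J y2, y' - y⟫ + ⟪J y2 - J y, y' - y⟫ := by
        rw [← inner_add_left]; congr 1; abel
      have g3 : c * r ≤ ‖J y2 - J y‖ := by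
        have := hlow y2 n1.le
        rwa [n1] at this
      have g4 : (c * r) ^ 2 ≤ ‖J y2 - J y‖ ^ 2 := by gcongr
      have g5 : ⟪J y' - J y, y' - y⟫ ≤ ‖J y' - J y‖ * ‖y' - y‖ := real_inner_le_norm _ _
      rw [hJy] at g5 g2 g1
      have g6 : ‖x' - J y‖ * ‖y' - y‖ < c ^ 2 * r * ‖y' - y‖ := by gcongr
      have g7 : s * ‖y' - y‖ = r := by rw [hs]; field_simp
      have g8 : s * ⟪J y2 - J y, y' - y⟫ ≤ s * (‖x' - J y‖ * ‖y' - y‖) := by gcongr; linarith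
      have g9 : s * (‖x' - J y‖ * ‖y' - y‖) < s * (c ^ 2 * r * ‖y' - y‖) := by gcongr
      have g10 : s * (c ^ 2 * r * ‖y' - y‖) = (c * r) ^ 2 := by
        calc _ = c ^ 2 * r * (s * ‖y' - y‖) := by ring
          _ = _ := by rw [g7]; ring
      linarith
    have h1 := hd' y' hclose
    have h2 := hlow y' hclose
    rw [hJy] at h1 h2
    have e : q' - (y - J y) - (S - ContinuousLinearMap.id ℝ V) (x' - J y)
        = -(S (x' - J y - T (y' - y))) := by
      rw [map_sub S (x' - J y), hST, hy']
      simp only [sub_apply, ContinuousLinearMap.id_apply]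
      abel
    rw [e, norm_neg]
    calc ‖S (x' - J y - T (y' - y))‖ ≤ ‖S‖ * ‖x' - J y - T (y' - y)‖ := S.le_opNorm _
      _ ≤ (‖S‖ + 1) * (κ * ‖y' - y‖) := by gcongr; linarith
      _ ≤ (‖S‖ + 1) * (η * c / (‖S‖ + 1) * ‖y' - y‖) := by gcongr; exact min_le_right _ _
      _ = η * (c * ‖y' - y‖) := by field_simp
      _ ≤ _ := by gcongr
  intro η hη
  obtain ⟨ρ, hρ, hρ'⟩ := hsub η hη
  rw [Metric.eventually_nhds_iff]
  refine ⟨ρ, hρ, fun x' hx' => ?_⟩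
  rw [dist_eq_norm] at hx'
  set B := S - ContinuousLinearMap.id ℝ V with hB
  set x := J y with hx
  set q := y - x with hq
  set h := x' - x with hh
  choose Q hQ using fun z => exists_subgrad hg z
  have hQb : ∀ t : ℝ, 0 ≤ t → t ≤ 1 →
      |⟪Q (x + t • h), h⟫ - ⟪q, h⟫ - t * ⟪B h, h⟫| ≤ η * ‖h‖ ^ 2 := by
    intro t ht0 ht1
    have e0 : x + t • h - x = t • h := by abel
    have h1 := hρ' (x + t • h) (Q (x + t • h)) (by
      rw [e0, norm_smul, Real.norm_of_nonneg ht0]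
      nlinarith [norm_nonneg h]) (hQ _)
    rw [e0] at h1
    have e1 : ⟪Q (x + t • h), h⟫ - ⟪q, h⟫ - t * ⟪B h, h⟫ = ⟪Q (x + t • h) - q - B (t • h), h⟫ := by
      have e2 : ∀ a b d : V, ⟪a, h⟫ - ⟪b, h⟫ - ⟪d, h⟫ = ⟪a - b - d, h⟫ := by
        intro a b d
        rw [inner_sub_left, inner_sub_left]
      rw [← e2, map_smul, real_inner_smul_left]
    rw [e1]
    calc _ ≤ ‖Q (x + t • h) - q - B (t • h)‖ * ‖h‖ := abs_real_inner_le_norm _ _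
      _ ≤ (η * ‖t • h‖) * ‖h‖ := by gcongr
      _ ≤ (η * ‖h‖) * ‖h‖ := by
        gcongr
        rw [norm_smul, Real.norm_of_nonneg ht0]
        nlinarith [norm_nonneg h]
      _ = _ := by ring
  have hinc : ∀ s t : ℝ, g (x + s • h) + (t - s) * ⟪Q (x + s • h), h⟫ ≤ g (x + t • h) := by
    intro s t
    have := hQ (x + s • h) (x + t • h)
    have e : x + t • h - (x + s • h) = (t - s) • h := by module
    rwa [e, inner_smul_right] at this
  set b := ⟪B h, h⟫ with hb
  have up := telescoping (k := fun t => g (x + t • h) - t * ⟪q, h⟫ - t ^ 2 / 2 * b) (b := b / 2)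
    (e := η * ‖h‖ ^ 2) (by
      intro s t hs hst ht
      have h1 := hinc t s
      have h2 := (abs_le.1 (hQb t (by linarith) ht)).2
      have h3 : (t - s) * (⟪Q (x + t • h), h⟫ - ⟪q, h⟫ - t * b) ≤ (t - s) * (η * ‖h‖ ^ 2) := by
        gcongr
      nlinarith)
  have dn := telescoping (k := fun t => -(g (x + t • h) - t * ⟪q, h⟫ - t ^ 2 / 2 * b)) (b := b / 2)
    (e := η * ‖h‖ ^ 2) (by
      intro s t hs hst ht
      have h1 := hinc s t
      have h2 := (abs_le.1 (hQb s (by linarith) (by linarith))).1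
      have h3 : (t - s) * (-(η * ‖h‖ ^ 2)) ≤ (t - s) * (⟪Q (x + s • h), h⟫ - ⟪q, h⟫ - s * b) := by
        gcongr
      nlinarith)
  have ex : x + h = x' := by rw [hh]; abel
  simp only [one_smul, zero_smul, add_zero, ex] at up dn
  rw [abs_le]
  constructor <;> nlinarith

theorem lipschitz_null {X Y : Type*} [NormedAddCommGroup X] [NormedSpace ℝ X]
    [FiniteDimensional ℝ X] [MeasurableSpace X] [BorelSpace X] [NormedAddCommGroup Y]
    [NormedSpace ℝ Y] [FiniteDimensional ℝ Y] [MeasurableSpace Y] [BorelSpace Y]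
    (hd : Module.finrank ℝ X = Module.finrank ℝ Y)
    (μ : MeasureTheory.Measure X) [μ.IsAddHaarMeasure]
    (ν : MeasureTheory.Measure Y) [ν.IsAddHaarMeasure] {f : X → Y} {K : NNReal} {s : Set X}
    (hf : LipschitzOnWith K f s) (hs : μ s = 0) : ν (f '' s) = 0 := by
  have h1 : (MeasureTheory.Measure.hausdorffMeasure (Module.finrank ℝ X : ℝ) :
      MeasureTheory.Measure X) s = 0 :=
    MeasureTheory.Measure.absolutelyContinuous_isAddHaarMeasure _ μ hs
  have h2 := hf.hausdorffMeasure_image_le (d := (Module.finrank ℝ X : ℝ)) (by positivity)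
  rw [h1, mul_zero, hd] at h2
  exact MeasureTheory.Measure.absolutelyContinuous_isAddHaarMeasure ν
    (MeasureTheory.Measure.hausdorffMeasure (Module.finrank ℝ Y : ℝ) :
      MeasureTheory.Measure Y) (le_antisymm h2 zero_le)

theorem alexandrov [MeasurableSpace V] [BorelSpace V] {g : V → ℝ} (hg : ConvexOn ℝ Set.univ g) :
    ∀ᵐ x : V, ∃ p B, Twice g x p B := by
  choose J hJ using fun y => exists_prox hg y
  have hfirm : ∀ y₁ y₂, ‖J y₁ - J y₂‖ ^ 2 ≤ ⟪J y₁ - J y₂, y₁ - y₂⟫ := by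
    intro y₁ y₂
    have := subgrad_firm (hJ y₁) (hJ y₂)
    simpa using this
  have hlip : LipschitzWith 1 J := by
    apply LipschitzWith.of_dist_le_mul
    intro a b
    rw [dist_eq_norm, dist_eq_norm, NNReal.coe_one, one_mul]
    have h1 := hfirm a b
    have h2 := real_inner_le_norm (J a - J b) (a - b)
    by_contra hc
    push Not at hc
    nlinarith [norm_nonneg (J a - J b), norm_nonneg (a - b)]
  have hJu : ∀ x q, (∀ z, g x + ⟪q, z - x⟫ ≤ g z) → J (x + q) = x := by
    intro x q hq
    have := subgrad_firm (hJ (x + q)) hq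
    simp only [add_sub_cancel, sub_self, inner_zero_right] at this
    have h0 : ‖J (x + q) - x‖ = 0 := by
      have := norm_nonneg (J (x + q) - x); nlinarith
    rwa [norm_eq_zero, sub_eq_zero] at h0
  have hN1 := hlip.ae_differentiableAt (μ := (MeasureTheory.volume : MeasureTheory.Measure V))
  have n1 : (MeasureTheory.volume : MeasureTheory.Measure V)
      (J '' {y | ¬ DifferentiableAt ℝ J y}) = 0 :=
    lipschitz_null rfl MeasureTheory.volume MeasureTheory.volume hlip.lipschitzOnWith hN1
  have n2 : (MeasureTheory.volume : MeasureTheory.Measure V)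
      (J '' {y | DifferentiableAt ℝ J y ∧ (fderiv ℝ J y).det = 0}) = 0 :=
    MeasureTheory.addHaar_image_eq_zero_of_det_fderivWithin_eq_zero _
      (fun x hx => hx.1.hasFDerivAt.hasFDerivWithinAt) (fun x hx => hx.2)
  have n3 := MeasureTheory.measure_union_null n1 n2
  refine MeasureTheory.measure_mono_null ?_ n3
  intro x hx
  obtain ⟨q, hq⟩ := exists_subgrad hg x
  have hxq := hJu x q hq
  by_cases hdif : DifferentiableAt ℝ J (x + q)
  · by_cases hdet : (fderiv ℝ J (x + q)).det = 0
    · exact Or.inr ⟨x + q, ⟨hdif, hdet⟩, hxq⟩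
    · exfalso
      apply hx
      obtain ⟨B, hB⟩ := twice_of_prox hg hJ hdif.hasFDerivAt hdet
      rw [hxq] at hB
      exact ⟨_, B, hB⟩
  · exact Or.inl ⟨x + q, hdif, hxq⟩

end Alexandrov

section Tests
variable {n : ℕ}

/-- symmetrised matrix of a linear map -/
noncomputable def Mat (B : EuclideanSpace ℝ (Fin n) →L[ℝ] EuclideanSpace ℝ (Fin n)) :
    Matrix (Fin n) (Fin n) ℝ :=
  Matrix.of fun i j =>
    1 / 2 * (⟪B (EuclideanSpace.single i (1 : ℝ)), EuclideanSpace.single j (1 : ℝ)⟫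
      + ⟪B (EuclideanSpace.single j (1 : ℝ)), EuclideanSpace.single i (1 : ℝ)⟫)

theorem Mat_symm (B : EuclideanSpace ℝ (Fin n) →L[ℝ] EuclideanSpace ℝ (Fin n)) :
    (Mat B).IsSymm := by
  ext i j
  simp only [Mat, Matrix.transpose_apply, Matrix.of_apply]
  ring

theorem Mat_add (B C : EuclideanSpace ℝ (Fin n) →L[ℝ] EuclideanSpace ℝ (Fin n)) :
    Mat (B + C) = Mat B + Mat C := by
  ext i j
  simp only [Mat, Matrix.add_apply, Matrix.of_apply, add_apply, inner_add_left]
  ring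

theorem Mat_smul (t : ℝ) (B : EuclideanSpace ℝ (Fin n) →L[ℝ] EuclideanSpace ℝ (Fin n)) :
    Mat (t • B) = t • Mat B := by
  ext i j
  simp only [Mat, Matrix.smul_apply, Matrix.of_apply, smul_apply, real_inner_smul_left, smul_eq_mul]
  ring

theorem euclid_sum (v : EuclideanSpace ℝ (Fin n)) :
    v = ∑ i, v i • EuclideanSpace.single i (1 : ℝ) := by
  ext j
  simp [Finset.sum_apply, Pi.single_apply]

theorem Mat_quad (B : EuclideanSpace ℝ (Fin n) →L[ℝ] EuclideanSpace ℝ (Fin n))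
    (w : Fin n → ℝ) :
    w ⬝ᵥ (Mat B).mulVec w = ⟪B (WithLp.toLp 2 w), WithLp.toLp 2 w⟫ := by
  have h : ⟪B (WithLp.toLp 2 w), WithLp.toLp 2 w⟫ = ∑ i, ∑ j, w i * w j *
      ⟪B (EuclideanSpace.single i (1 : ℝ)), EuclideanSpace.single j (1 : ℝ)⟫ := by
    conv_lhs => rw [euclid_sum (WithLp.toLp 2 w)]
    simp only [map_sum, map_smul, sum_inner, inner_sum, real_inner_smul_left, inner_smul_right,
      Finset.mul_sum]
    rw [Finset.sum_comm]
    refine Finset.sum_congr rfl fun i _ => Finset.sum_congr rfl fun j _ => by ring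
  rw [h]
  simp only [dotProduct, Matrix.mulVec, Mat, Matrix.of_apply, Finset.mul_sum]
  have h2 : ∑ i, ∑ j, w i * w j *
      ⟪B (EuclideanSpace.single i (1 : ℝ)), EuclideanSpace.single j (1 : ℝ)⟫ =
      ∑ i, ∑ j, w i * w j *
      ⟪B (EuclideanSpace.single j (1 : ℝ)), EuclideanSpace.single i (1 : ℝ)⟫ := by
    rw [Finset.sum_comm]
    refine Finset.sum_congr rfl fun i _ => Finset.sum_congr rfl fun j _ => by ring
  have h3 : ∀ S T : ℝ, S = T → 1 / 2 * (S + T) = S := by intro S T h; linarith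
  rw [← h3 _ _ h2, ← Finset.sum_add_distrib, Finset.mul_sum]
  refine Finset.sum_congr rfl fun i _ => ?_
  rw [← Finset.sum_add_distrib, Finset.mul_sum]
  refine Finset.sum_congr rfl fun j _ => ?_
  ring

theorem Mat_psd (B : EuclideanSpace ℝ (Fin n) →L[ℝ] EuclideanSpace ℝ (Fin n))
    (h : ∀ v, 0 ≤ ⟪B v, v⟫) : (Mat B).PosSemidef := by
  refine Matrix.PosSemidef.of_dotProduct_mulVec_nonneg ?_ ?_
  · have := Mat_symm B
    rw [Matrix.IsHermitian, Matrix.conjTranspose_eq_transpose_of_trivial]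
    exact this
  · intro w
    have := h (WithLp.toLp 2 w)
    rw [← Mat_quad] at this
    simpa using this

theorem Mat_id_trace : (Mat (ContinuousLinearMap.id ℝ (EuclideanSpace ℝ (Fin n)))).trace = n := by
  simp [Matrix.trace, Mat]
  norm_num

theorem Mat_rank1_trace (d : EuclideanSpace ℝ (Fin n)) :
    (Mat ((innerSL ℝ d).smulRight d)).trace = ‖d‖ ^ 2 := by
  rw [EuclideanSpace.norm_sq_eq]
  simp only [Matrix.trace, Mat, Matrix.diag, Matrix.of_apply]
  refine Finset.sum_congr rfl fun i _ => ?_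
  simp [ContinuousLinearMap.smulRight_apply, real_inner_smul_left, EuclideanSpace.inner_single_right]
  ring

noncomputable def quadTest (c : ℝ) (p x₀ : EuclideanSpace ℝ (Fin n))
    (B : EuclideanSpace ℝ (Fin n) →L[ℝ] EuclideanSpace ℝ (Fin n))
    (x : EuclideanSpace ℝ (Fin n)) : ℝ :=
  c + ⟪p, x - x₀⟫ + 1 / 2 * ⟪B (x - x₀), x - x₀⟫

theorem quadTest_contDiff (c : ℝ) (p x₀ : EuclideanSpace ℝ (Fin n))
    (B : EuclideanSpace ℝ (Fin n) →L[ℝ] EuclideanSpace ℝ (Fin n)) :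
    ContDiff ℝ 2 (quadTest c p x₀ B) := by
  unfold quadTest
  exact (contDiff_const.add (contDiff_const.inner ℝ (contDiff_id.sub contDiff_const))).add
    (contDiff_const.mul ((B.contDiff.comp (contDiff_id.sub contDiff_const)).inner ℝ
      (contDiff_id.sub contDiff_const)))

theorem quadTest_fderiv (c : ℝ) (p x₀ : EuclideanSpace ℝ (Fin n))
    (B : EuclideanSpace ℝ (Fin n) →L[ℝ] EuclideanSpace ℝ (Fin n)) (x : EuclideanSpace ℝ (Fin n)) :
    HasFDerivAt (quadTest c p x₀ B)
      (innerSL ℝ p + (1 / 2 : ℝ) • (innerSL ℝ (B (x - x₀)) + (innerSL ℝ (x - x₀)).comp B)) x := by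
  have h0 : HasFDerivAt (fun x => x - x₀) (ContinuousLinearMap.id ℝ (EuclideanSpace ℝ (Fin n))) x :=
    (hasFDerivAt_id x).sub_const x₀
  have h1 := ((innerSL ℝ p).hasFDerivAt (x := x - x₀)).comp x h0
  have h2 := ((B.hasFDerivAt (x := x - x₀)).comp x h0).inner ℝ h0
  have h3 := (h1.const_add c).add (h2.const_mul (1 / 2 : ℝ))
  unfold quadTest
  refine h3.congr_fderiv ?_
  ext v
  simp [fderivInnerCLM_apply, real_inner_comm, inner_sub_left, inner_sub_right]
  ring

theorem quadTest_gradient (c : ℝ) (p x₀ : EuclideanSpace ℝ (Fin n))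
    (B : EuclideanSpace ℝ (Fin n) →L[ℝ] EuclideanSpace ℝ (Fin n)) :
    gradient (quadTest c p x₀ B) x₀ = p := by
  apply HasGradientAt.gradient
  rw [hasGradientAt_iff_hasFDerivAt]
  refine (quadTest_fderiv c p x₀ B x₀).congr_fderiv ?_
  ext v
  simp

theorem quadTest_hessian (c : ℝ) (p x₀ : EuclideanSpace ℝ (Fin n))
    (B : EuclideanSpace ℝ (Fin n) →L[ℝ] EuclideanSpace ℝ (Fin n)) :
    hessianMatrix (quadTest c p x₀ B) x₀ = Mat B := by
  ext i j
  simp only [hessianMatrix, Matrix.of_apply, iteratedFDeriv_two_apply, Matrix.cons_val_zero,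
    Matrix.cons_val_one]
  have e : fderiv ℝ (quadTest c p x₀ B) = fun x =>
      innerSL ℝ p + (1 / 2 : ℝ) • (innerSL ℝ (B (x - x₀)) + (innerSL ℝ (x - x₀)).comp B) :=
    funext fun x => (quadTest_fderiv c p x₀ B x).fderiv
  rw [e]
  set ei : EuclideanSpace ℝ (Fin n) := EuclideanSpace.single i 1
  set ej : EuclideanSpace ℝ (Fin n) := EuclideanSpace.single j 1
  have hd : DifferentiableAt ℝ (fun x => innerSL ℝ p + (1 / 2 : ℝ) •
      (innerSL ℝ (B (x - x₀)) + (innerSL ℝ (x - x₀)).comp B)) x₀ := by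
    rw [← e]
    exact ((quadTest_contDiff c p x₀ B).fderiv_right (m := 1) (by norm_num)).differentiable
      (by norm_num) x₀
  have h1 := hd.hasFDerivAt.clm_apply (hasFDerivAt_const ej x₀)
  have h2 : HasFDerivAt (fun x => (innerSL ℝ p + (1 / 2 : ℝ) •
      (innerSL ℝ (B (x - x₀)) + (innerSL ℝ (x - x₀)).comp B)) ej)
      ((1 / 2 : ℝ) • ((innerSL ℝ ej).comp B + innerSL ℝ (B ej))) x₀ := by
    have h3 : HasFDerivAt (fun x => ((1 / 2 : ℝ) • ((innerSL ℝ ej).comp B + innerSL ℝ (B ej))) (x - x₀))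
      ((1 / 2 : ℝ) • ((innerSL ℝ ej).comp B + innerSL ℝ (B ej))) x₀ := by
      have h0 : HasFDerivAt (fun x => x - x₀)
        (ContinuousLinearMap.id ℝ (EuclideanSpace ℝ (Fin n))) x₀ := (hasFDerivAt_id x₀).sub_const x₀
      have h5 := ((1 / 2 : ℝ) • ((innerSL ℝ ej).comp B + innerSL ℝ (B ej))).hasFDerivAt
        (x := x₀ - x₀)
      exact HasFDerivAt.comp (f := fun x => x - x₀) x₀ h5 h0
    refine (h3.const_add ⟪p, ej⟫).congr_of_eventuallyEq (Eventually.of_forall fun x => ?_)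
    simp [real_inner_comm, inner_sub_left, inner_sub_right]
    try ring
  have h4 := congrArg (fun T => T ei) (h1.unique h2)
  simp only [ContinuousLinearMap.comp_zero, zero_add, ContinuousLinearMap.flip_apply] at h4
  simp only [Mat, Matrix.of_apply]
  refine Eq.trans ?_ (h4.trans ?_)
  · rfl
  · simp [real_inner_comm, ei, ej]
    ring

theorem sub_jet {F : Matrix (Fin n) (Fin n) ℝ → ℝ} {H f u : EuclideanSpace ℝ (Fin n) → ℝ} {δ : ℝ}
    (hu : IsSubsolutionDisc F H f δ u) {x₀ p : EuclideanSpace ℝ (Fin n)}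
    {B : EuclideanSpace ℝ (Fin n) →L[ℝ] EuclideanSpace ℝ (Fin n)}
    (h : ∀ᶠ x in nhds x₀, u x ≤ u x₀ + ⟪p, x - x₀⟫ + 1 / 2 * ⟪B (x - x₀), x - x₀⟫) :
    δ * u x₀ + F (Mat B) - f x₀ ≤ 0 ∧ H p ≤ 0 := by
  have := hu (quadTest (u x₀) p x₀ B) (quadTest_contDiff _ _ _ _) x₀ (by
    filter_upwards [h] with x hx
    simp only [quadTest, sub_self, map_zero, inner_zero_right, mul_zero, add_zero]
    linarith)
  rw [quadTest_gradient, quadTest_hessian] at this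
  exact max_le_iff.1 this

theorem super_jet {F : Matrix (Fin n) (Fin n) ℝ → ℝ} {H f u : EuclideanSpace ℝ (Fin n) → ℝ} {δ : ℝ}
    (hu : IsSupersolutionDisc F H f δ u) {x₀ p : EuclideanSpace ℝ (Fin n)}
    {B : EuclideanSpace ℝ (Fin n) →L[ℝ] EuclideanSpace ℝ (Fin n)}
    (h : ∀ᶠ x in nhds x₀, u x₀ + ⟪p, x - x₀⟫ + 1 / 2 * ⟪B (x - x₀), x - x₀⟫ ≤ u x)
    (hp : H p < 0) :
    0 ≤ δ * u x₀ + F (Mat B) - f x₀ := by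
  have := hu (quadTest (u x₀) p x₀ B) (quadTest_contDiff _ _ _ _) x₀ (by
    filter_upwards [h] with x hx
    simp only [quadTest, sub_self, map_zero, inner_zero_right, mul_zero, add_zero]
    linarith)
  rw [quadTest_gradient, quadTest_hessian] at this
  rcases le_max_iff.1 this with h1 | h1
  · exact h1
  · linarith

end Tests

open scoped RealInnerProductSpace
open Filter

section Jensen

theorem lin_zero {X : Type*} [NormedAddCommGroup X] [NormedSpace ℝ X] {l : X →L[ℝ] ℝ} {K : ℝ}
    (h : ∀ k, l k ≤ K * ‖k‖ ^ 2) : l = 0 := by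
  have h1 : ∀ k, l k ≤ 0 := by
    intro k
    by_contra hc
    push Not at hc
    have h2 : ∀ t : ℝ, 0 < t → l k ≤ t * (K * ‖k‖ ^ 2) := by
      intro t ht
      have := h (t • k)
      rw [map_smul, norm_smul, smul_eq_mul, Real.norm_of_nonneg ht.le] at this
      have h3 : t * l k ≤ t * (t * (K * ‖k‖ ^ 2)) := by nlinarith
      exact le_of_mul_le_mul_left h3 ht
    have h3 := h2 1 one_pos
    have h4 : 0 < K * ‖k‖ ^ 2 := by linarith
    have h5 := h2 (l k / (2 * (K * ‖k‖ ^ 2))) (by positivity)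
    have : l k / (2 * (K * ‖k‖ ^ 2)) * (K * ‖k‖ ^ 2) = l k / 2 := by
      generalize K * ‖k‖ ^ 2 = c at h4
      field_simp
    linarith
  ext k
  have := h1 (-k)
  rw [map_neg] at this
  simp only [zero_apply]
  linarith [h1 k]

theorem jensen {X : Type*} [NormedAddCommGroup X] [NormedSpace ℝ X] [FiniteDimensional ℝ X]
    [MeasurableSpace X] [BorelSpace X] (μ : MeasureTheory.Measure X) [μ.IsAddHaarMeasure]
    {W : X → ℝ} {K ρ : ℝ} (hK0 : 0 ≤ K) (hρ : 0 < ρ)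
    (hK : ∀ v0, ∃ l : X →L[ℝ] ℝ, ∀ v, W v0 + l (v - v0) - K * ‖v - v0‖ ^ 2 ≤ W v)
    (hmax : ∀ p : X →L[ℝ] ℝ, ‖p‖ ≤ ρ → ∃ v, ∀ v', W v' - p v' ≤ W v - p v)
    (N : Set X) (hN : μ N = 0) :
    ∃ v ∉ N, ∃ p : X →L[ℝ] ℝ, ‖p‖ ≤ ρ ∧ ∀ v', W v' - p v' ≤ W v - p v := by
  by_contra hcon
  push Not at hcon
  set S : Set X := {v | ∃ p : X →L[ℝ] ℝ, ‖p‖ ≤ ρ ∧ ∀ v', W v' - p v' ≤ W v - p v} with hS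
  have hSN : S ⊆ N := by
    rintro v ⟨p, hp, hpv⟩
    by_contra hv
    obtain ⟨v', hv'⟩ := hcon v hv p hp
    exact absurd (hpv v') (not_le.2 hv')
  have hS0 : μ S = 0 := MeasureTheory.measure_mono_null hSN hN
  -- lower quadratic bound with the slope `p`
  have hlow : ∀ (v : X) (p : X →L[ℝ] ℝ), (∀ v', W v' - p v' ≤ W v - p v) →
      ∀ y, W v + p (y - v) - K * ‖y - v‖ ^ 2 ≤ W y := by
    intro v p hp
    obtain ⟨l, hl⟩ := hK v
    have : l - p = 0 := by
      apply lin_zero (K := K)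
      intro k
      have h1 := hl (v + k)
      have h2 := hp (v + k)
      simp only [add_sub_cancel_left, map_add] at h1 h2
      simp only [sub_apply]
      linarith
    rw [sub_eq_zero] at this
    rw [← this]; exact hl
  have hkey : ∀ (v v' : X) (p p' : X →L[ℝ] ℝ), (∀ y, W y - p y ≤ W v - p v) →
      (∀ y, W y - p' y ≤ W v' - p' v') → ‖p' - p‖ ≤ 4 * K * ‖v - v'‖ := by
    intro v v' p p' hp hp'
    have h1 : ∀ k, (p' - p) k ≤ K * (‖k‖ + ‖v - v'‖) ^ 2 := by
      intro k
      have h2 := hlow v' p' hp' (v + k)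
      have h3 := hp (v + k)
      have h4 := hp' v
      have h5 : ‖v + k - v'‖ ≤ ‖k‖ + ‖v - v'‖ := by
        have : v + k - v' = k + (v - v') := by abel
        rw [this]; exact norm_add_le _ _
      have h6 : ‖v + k - v'‖ ^ 2 ≤ (‖k‖ + ‖v - v'‖) ^ 2 := by gcongr
      have h7 := mul_le_mul_of_nonneg_left h6 hK0
      simp only [map_add, map_sub, sub_apply] at *
      linarith
    rcases eq_or_ne v v' with rfl | hne
    · have : p' - p = 0 := by
        apply lin_zero (K := K)
        intro k
        simpa using h1 k
      rw [this]; simp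
    · have hD : 0 < ‖v - v'‖ := norm_pos_iff.2 (sub_ne_zero.2 hne)
      have h8 : ∀ x, (p' - p) x ≤ 4 * K * ‖v - v'‖ * ‖x‖ := by
        intro x
        rcases eq_or_ne x 0 with rfl | hx
        · simp
        · have hx' : 0 < ‖x‖ := norm_pos_iff.2 hx
          have h9 := h1 ((‖v - v'‖ / ‖x‖) • x)
          rw [map_smul, norm_smul, Real.norm_of_nonneg (by positivity), smul_eq_mul,
            div_mul_cancel₀ _ hx'.ne'] at h9
          have h10 : (p' - p) x = ‖x‖ / ‖v - v'‖ * (‖v - v'‖ / ‖x‖ * (p' - p) x) := by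
            field_simp
          rw [h10]
          calc _ ≤ ‖x‖ / ‖v - v'‖ * (K * (‖v - v'‖ + ‖v - v'‖) ^ 2) := by gcongr
            _ = _ := by field_simp; ring
      refine ContinuousLinearMap.opNorm_le_bound _ (by positivity) fun x => ?_
      rw [Real.norm_eq_abs, abs_le]
      have := h8 (-x)
      rw [map_neg, norm_neg] at this
      exact ⟨by linarith, h8 x⟩
  choose! g hg1 hg2 using fun v (hv : v ∈ S) => hv
  let : MeasurableSpace (X →L[ℝ] ℝ) := borel _
  have : BorelSpace (X →L[ℝ] ℝ) := ⟨rfl⟩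
  have hlip : LipschitzOnWith (Real.toNNReal (4 * K)) g S := by
    apply LipschitzOnWith.of_dist_le_mul
    intro v hv v' hv'
    rw [Real.coe_toNNReal _ (by positivity), dist_comm (g v), dist_eq_norm, dist_eq_norm]
    exact hkey v v' _ _ (hg2 v hv) (hg2 v' hv')
  have hfr : Module.finrank ℝ X = Module.finrank ℝ (X →L[ℝ] ℝ) := by
    have e : (X →ₗ[ℝ] ℝ) ≃ₗ[ℝ] (X →L[ℝ] ℝ) := LinearMap.toContinuousLinearMap
    rw [← e.finrank_eq]
    exact (Subspace.dual_finrank_eq (K := ℝ) (V := X)).symm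
  have hn := lipschitz_null hfr μ (MeasureTheory.Measure.addHaar (G := X →L[ℝ] ℝ)) hlip hS0
  have hsub : Metric.closedBall (0 : X →L[ℝ] ℝ) ρ ⊆ g '' S := by
    intro p hp
    rw [mem_closedBall_zero_iff] at hp
    obtain ⟨v, hv⟩ := hmax p hp
    have hvS : v ∈ S := ⟨p, hp, hv⟩
    refine ⟨v, hvS, ?_⟩
    have := hkey v v p (g v) hv (hg2 v hvS)
    simp only [sub_self, norm_zero, mul_zero] at this
    exact sub_eq_zero.1 (norm_le_zero_iff.1 this)
  have h0 := MeasureTheory.measure_mono_null hsub hn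
  exact absurd h0 (Metric.measure_closedBall_pos _ _ hρ).ne'

end Jensen

open scoped RealInnerProductSpace
open Filter

section SupConvolution
set_option linter.unusedSectionVars false
variable {V : Type*} [NormedAddCommGroup V] [InnerProductSpace ℝ V] [FiniteDimensional ℝ V]

theorem ae_lin {X Y : Type*} [NormedAddCommGroup X] [NormedSpace ℝ X]
    [FiniteDimensional ℝ X] [MeasurableSpace X] [BorelSpace X] [NormedAddCommGroup Y]
    [NormedSpace ℝ Y] [MeasurableSpace Y] [BorelSpace Y]
    (μ : MeasureTheory.Measure X) [μ.IsAddHaarMeasure]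
    (ν : MeasureTheory.Measure Y) [ν.IsAddHaarMeasure] (L : X →ₗ[ℝ] Y)
    (hL : Function.Surjective L) {P : Y → Prop} (h : ∀ᵐ y ∂ν, P y) : ∀ᵐ x ∂μ, P (L x) := by
  have h0 : ν {y | ¬ P y} = 0 := h
  obtain ⟨t, ht, htm, ht0⟩ := MeasureTheory.exists_measurable_superset_of_null h0
  have h1 : ∀ᵐ y ∂ν, y ∈ tᶜ := by
    rw [MeasureTheory.ae_iff]; simpa using ht0
  have h2 := (MeasureTheory.ae_comp_linearMap_mem_iff L μ ν hL htm.compl).2 h1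
  filter_upwards [h2] with x hx
  by_contra hc
  exact hx (ht hc)

/-- `g` is the sup-convolution of `u`, with maximisers `m`. -/
def SupConv (ε : ℝ) (u g : V → ℝ) (m : V → V) : Prop :=
  ∀ z, g z = u (m z) - 1 / (2 * ε) * ‖z - m z‖ ^ 2 ∧ ∀ w, u w - 1 / (2 * ε) * ‖z - w‖ ^ 2 ≤ g z

theorem supConv_exists {u : V → ℝ} (hu : Continuous u) {A : ℝ} (hA : 0 ≤ A)
    (hg : ∀ z, u z ≤ A + A * ‖z‖) {ε : ℝ} (hε : 0 < ε) : ∃ g m, SupConv ε u g m := by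
  have : ∀ z, ∃ w, ∀ w', u w' - 1 / (2 * ε) * ‖z - w'‖ ^ 2 ≤ u w - 1 / (2 * ε) * ‖z - w‖ ^ 2 := by
    intro z
    have hk : Continuous (fun w => u w - 1 / (2 * ε) * ‖z - w‖ ^ 2) := by fun_prop
    have hpos : 0 < 1 / (2 * ε) := by positivity
    set q := 1 / (2 * ε) with hq
    obtain ⟨w, hw⟩ := hk.exists_forall_ge' z (by
      filter_upwards [ev_cocompact z (A / q + (A + A * ‖z‖ + |u z|) / q + 1)] with w hw
      have h1 := hg w
      have h2 : ‖w‖ ≤ ‖w - z‖ + ‖z‖ := by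
        have := norm_add_le (w - z) z
        simpa using this
      have h3 : u w ≤ A + A * ‖z‖ + A * ‖w - z‖ := by nlinarith
      rw [norm_sub_rev z w]
      simp only [sub_self, norm_zero]
      have h4 := neg_abs_le (u z)
      set t := ‖w - z‖ with ht
      have hB : 0 ≤ (A + A * ‖z‖ + |u z|) := by positivity
      have hB' : 0 ≤ (A + A * ‖z‖ + |u z|) / q := by positivity
      have hA' : 0 ≤ A / q := by positivity
      have h5 : 1 < t := by linarith
      have h6 : q * (A / q + (A + A * ‖z‖ + |u z|) / q) ≤ q * t := by
        apply mul_le_mul_of_nonneg_left _ hpos.le; linarith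
      have h7 : q * (A / q + (A + A * ‖z‖ + |u z|) / q) = A + (A + A * ‖z‖ + |u z|) := by
        field_simp
      rw [h7] at h6
      have h8 : (A + (A + A * ‖z‖ + |u z|)) * t ≤ q * t ^ 2 := by nlinarith
      nlinarith)
    exact ⟨w, hw⟩
  choose m hm using this
  exact ⟨fun z => u (m z) - 1 / (2 * ε) * ‖z - m z‖ ^ 2, m, fun z => ⟨rfl, hm z⟩⟩

theorem SupConv.le {ε : ℝ} {u g : V → ℝ} {m : V → V} (h : SupConv ε u g m) (z : V) : u z ≤ g z := by
  have := (h z).2 z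
  simpa using this

theorem SupConv.lower {ε : ℝ} {u g : V → ℝ} {m : V → V} (h : SupConv ε u g m) (z₀ z : V) :
    g z₀ + 1 / ε * ⟪m z₀ - z₀, z - z₀⟫ - 1 / (2 * ε) * ‖z - z₀‖ ^ 2 ≤ g z := by
  have h1 := (h z).2 (m z₀)
  have h2 := (h z₀).1
  have h3 : ‖z - m z₀‖ ^ 2 = ‖z - z₀‖ ^ 2 - 2 * ⟪m z₀ - z₀, z - z₀⟫ + ‖z₀ - m z₀‖ ^ 2 := by
    have e : z - m z₀ = (z - z₀) - (m z₀ - z₀) := by abel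
    rw [e, norm_sub_sq_real, norm_sub_rev (m z₀), real_inner_comm]
  rw [h3] at h1
  have e : 1 / ε = 2 * (1 / (2 * ε)) := by
    rcases eq_or_ne ε 0 with rfl | h
    · simp
    · field_simp
  rw [h2, e]
  linarith

theorem convex_of_subgrad {G : V → ℝ} (h : ∀ x, ∃ q : V, ∀ y, G x + ⟪q, y - x⟫ ≤ G y) :
    ConvexOn ℝ Set.univ G := by
  refine ⟨convex_univ, fun x _ y _ a b ha hb hab => ?_⟩
  obtain ⟨q, hq⟩ := h (a • x + b • y)
  have h1 := hq x
  have h2 := hq y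
  have e1 : x - (a • x + b • y) = b • (x - y) := by
    have : a = 1 - b := by linarith
    subst this; module
  have e2 : y - (a • x + b • y) = (-a) • (x - y) := by
    have : a = 1 - b := by linarith
    subst this; module
  rw [e1, inner_smul_right] at h1
  rw [e2, inner_smul_right] at h2
  simp only [smul_eq_mul]
  have m1 := mul_le_mul_of_nonneg_left h1 ha
  have m2 := mul_le_mul_of_nonneg_left h2 hb
  have e3 : G (a • x + b • y) = a * G (a • x + b • y) + b * G (a • x + b • y) := by
    rw [← add_mul, hab, one_mul]
  rw [e3]
  nlinarith

theorem SupConv.convex {ε : ℝ} {u g : V → ℝ} {m : V → V} (h : SupConv ε u g m) :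
    ConvexOn ℝ Set.univ (fun z => g z + 1 / (2 * ε) * ‖z‖ ^ 2) := by
  apply convex_of_subgrad
  intro x
  refine ⟨(1 / ε) • m x, fun y => ?_⟩
  have h1 := h.lower x y
  have h2 : ‖y‖ ^ 2 = ‖y - x‖ ^ 2 + 2 * ⟪x, y - x⟫ + ‖x‖ ^ 2 := by
    have : y = (y - x) + x := by abel
    conv_lhs => rw [this, norm_add_sq_real, real_inner_comm]
  have e : 1 / ε = 2 * (1 / (2 * ε)) := by
    rcases eq_or_ne ε 0 with rfl | h
    · simp
    · field_simp
  rw [real_inner_smul_left, h2]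
  rw [inner_sub_left] at h1
  rw [e] at h1 ⊢
  linarith

theorem SupConv.continuous {ε : ℝ} {u g : V → ℝ} {m : V → V} (h : SupConv ε u g m) :
    Continuous g := by
  have h1 := h.convex.locallyLipschitz.continuous
  have h2 : Continuous (fun z : V => 1 / (2 * ε) * ‖z‖ ^ 2) := by fun_prop
  have := h1.sub h2
  refine this.congr fun z => ?_
  simp

theorem SupConv.twice [MeasurableSpace V] [BorelSpace V] {ε : ℝ} {u g : V → ℝ} {m : V → V}
    (h : SupConv ε u g m) : ∀ᵐ z : V, ∃ p B, Twice g z p B := by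
  filter_upwards [alexandrov h.convex] with z hz
  obtain ⟨p, B, hpB⟩ := hz
  refine ⟨p - (1 / ε) • z, B - (1 / ε) • ContinuousLinearMap.id ℝ V, fun η hη => ?_⟩
  filter_upwards [hpB η hη] with y hy
  convert hy using 2
  have h2 : ‖y‖ ^ 2 = ‖y - z‖ ^ 2 + 2 * ⟪z, y - z⟫ + ‖z‖ ^ 2 := by
    have : y = (y - z) + z := by abel
    conv_lhs => rw [this, norm_add_sq_real, real_inner_comm]
  have e : 1 / ε = 2 * (1 / (2 * ε)) := by
    rcases eq_or_ne ε 0 with rfl | h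
    · simp
    · field_simp
  rw [h2, inner_sub_left, real_inner_smul_left, sub_apply, smul_apply, inner_sub_left,
    real_inner_smul_left, ContinuousLinearMap.id_apply, real_inner_self_eq_norm_sq, e]
  ring

theorem SupConv.jet {ε : ℝ} {u g : V → ℝ} {m : V → V} (h : SupConv ε u g m) {z P : V}
    {Z : V →L[ℝ] V} (hz : Twice g z P Z) {η : ℝ} (hη : 0 < η) :
    ∀ᶠ w in nhds (m z), u w ≤ u (m z) + ⟪P, w - m z⟫ +
      1 / 2 * ⟪(Z + (2 * η) • ContinuousLinearMap.id ℝ V) (w - m z), w - m z⟫ := by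
  have ht : Tendsto (fun w => w - m z + z) (nhds (m z)) (nhds z) := by
    have : Continuous (fun w => w - m z + z) := by fun_prop
    have := this.tendsto (m z)
    simpa using this
  filter_upwards [ht.eventually (hz η hη)] with w hw
  have h1 := (h (w - m z + z)).2 w
  have h2 := (h z).1
  have e : w - m z + z - w = z - m z := by abel
  rw [e] at h1
  rw [add_sub_cancel_right] at hw
  have h3 := (abs_le.1 hw).2
  rw [add_apply, smul_apply, inner_add_left, real_inner_smul_left, ContinuousLinearMap.id_apply,
    real_inner_self_eq_norm_sq]
  linarith

theorem SupConv.growth {ε : ℝ} (hε : 0 < ε) (hε1 : ε ≤ 1) {u g : V → ℝ} {m : V → V}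
    (h : SupConv ε u g m) {ψ : V → ℝ} {C Λ : ℝ} (hu : ∀ w, u w ≤ ψ w + C)
    (hψ : ∀ w z, ψ w ≤ ψ z + Λ * ‖w - z‖) (z : V) : g z ≤ ψ z + C + Λ ^ 2 / 2 := by
  rw [(h z).1]
  have h1 := hu (m z)
  have h2 := hψ (m z) z
  rw [norm_sub_rev] at h2
  have h3 : 1 / 2 * ‖z - m z‖ ^ 2 ≤ 1 / (2 * ε) * ‖z - m z‖ ^ 2 := by
    apply mul_le_mul_of_nonneg_right _ (sq_nonneg _)
    apply one_div_le_one_div_of_le (by positivity) (by linarith)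
  nlinarith [sq_nonneg (Λ - ‖z - m z‖)]

theorem SupConv.dist {u : V → ℝ} {A : ℝ} (hA : 0 ≤ A) (hu : ∀ z, |u z| ≤ A + A * ‖z‖) (R : ℝ)
    (hR : 0 ≤ R) :
    ∃ M, 0 ≤ M ∧ ∀ ε : ℝ, 0 < ε → ε ≤ 1 → ∀ g m, SupConv ε u g m → ∀ z, ‖z‖ ≤ R →
      ‖m z - z‖ ^ 2 ≤ ε * M := by
  set M := 2 * A + 2 * A * R with hM
  have hM0 : 0 ≤ M := by positivity
  refine ⟨2 * (M + A * (2 * A + 2 * M + 1)), by positivity, ?_⟩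
  intro ε hε hε1 g m h z hz
  have h1 := h.le z
  rw [(h z).1, norm_sub_rev] at h1
  set D := ‖m z - z‖ with hD
  have hD0 : 0 ≤ D := norm_nonneg _
  have h2 : ‖m z‖ ≤ D + R := by
    have := norm_add_le (m z - z) z
    simp only [sub_add_cancel] at this
    linarith
  have h3 : u (m z) - u z ≤ M + A * D := by
    have a1 := (abs_le.1 (hu (m z))).2
    have a2 := (abs_le.1 (hu z)).1
    nlinarith
  have h4 : D ^ 2 ≤ 2 * ε * (M + A * D) := by
    have : 1 / (2 * ε) * D ^ 2 ≤ M + A * D := by linarith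
    rw [div_mul_eq_mul_div, one_mul, div_le_iff₀ (by positivity)] at this
    linarith
  have h5 : D ≤ 2 * A + 2 * M + 1 := by
    by_contra hc
    push Not at hc
    have h6 : 2 * ε * (M + A * D) ≤ 2 * (M + A * D) := by
      have : 0 ≤ M + A * D := by positivity
      nlinarith
    nlinarith
  have h6 : A * D ≤ A * (2 * A + 2 * M + 1) := mul_le_mul_of_nonneg_left h5 hA
  nlinarith

theorem Twice.line {g : V → ℝ} {z P : V} {Z : V →L[ℝ] V} (hz : Twice g z P Z) (ξ : V) {η : ℝ}
    (hη : 0 < η) :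
    ∀ᶠ t : ℝ in nhds 0, |g (z + t • ξ) - g z - t * ⟪P, ξ⟫ - t ^ 2 * (1 / 2 * ⟪Z ξ, ξ⟫)| ≤ η * t ^ 2 := by
  have hp : 0 < η / (‖ξ‖ ^ 2 + 1) := by positivity
  have ht : Tendsto (fun t : ℝ => z + t • ξ) (nhds 0) (nhds z) := by
    have : Continuous (fun t : ℝ => z + t • ξ) := by fun_prop
    have := this.tendsto 0
    simpa using this
  filter_upwards [ht.eventually (hz _ hp)] with t h
  rw [add_sub_cancel_left, inner_smul_right, map_smul, real_inner_smul_left, inner_smul_right,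
    norm_smul, mul_pow, Real.norm_eq_abs, sq_abs] at h
  have e : t ^ 2 * (1 / 2 * ⟪Z ξ, ξ⟫) = 1 / 2 * (t * (t * ⟪Z ξ, ξ⟫)) := by ring
  rw [e]
  refine h.trans ?_
  have : η / (‖ξ‖ ^ 2 + 1) * (t ^ 2 * ‖ξ‖ ^ 2) = η * t ^ 2 * (‖ξ‖ ^ 2 / (‖ξ‖ ^ 2 + 1)) := by
    field_simp
  rw [this]
  apply mul_le_of_le_one_right (by positivity)
  rw [div_le_one (by positivity)]
  linarith

theorem first_order {a b : ℝ} (h : ∀ᶠ t : ℝ in nhds 0, t * a + t ^ 2 * b ≤ t ^ 2) : a = 0 := by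
  obtain ⟨r, hr, hb⟩ := Metric.eventually_nhds_iff.1 h
  by_contra ha
  have hC : 0 < |a| := abs_pos.2 ha
  set s := min (r / 2) (|a| / (2 * (1 + |b|))) with hs
  have hs0 : 0 < s := by positivity
  have hsr : s < r := lt_of_le_of_lt (min_le_left _ _) (by linarith)
  have hsb : s * (1 + |b|) ≤ |a| / 2 := by
    calc s * (1 + |b|) ≤ (|a| / (2 * (1 + |b|))) * (1 + |b|) := by gcongr; exact min_le_right _ _
      _ = |a| / 2 := by field_simp
  have h1 := hb (y := s) (by simpa [abs_of_pos hs0] using hsr)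
  have h2 := hb (y := -s) (by simpa [abs_of_pos hs0] using hsr)
  have h3 : s * |a| ≤ s ^ 2 - s ^ 2 * b := by
    rcases abs_cases a with ⟨h, _⟩ | ⟨h, _⟩ <;> rw [h] <;> nlinarith
  have h4 := neg_abs_le b
  have h5 : s * |a| ≤ s * (s * (1 + |b|)) := by nlinarith [sq_nonneg s]
  have h6 : s * |a| ≤ s * (|a| / 2) := h5.trans (mul_le_mul_of_nonneg_left hsb hs0.le)
  have := le_of_mul_le_mul_left h6 hs0
  linarith

theorem second_order {a b : ℝ} (h : ∀ η : ℝ, 0 < η → ∀ᶠ t : ℝ in nhds 0, t * a + t ^ 2 * b ≤ η * t ^ 2) :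
    b ≤ 0 := by
  apply le_of_forall_pos_le_add
  intro η hη
  obtain ⟨r, hr, hb⟩ := Metric.eventually_nhds_iff.1 (h η hη)
  have h1 := hb (y := r / 2) (by simp [abs_of_pos hr]; linarith)
  have h2 := hb (y := -(r / 2)) (by simp [abs_of_pos hr]; linarith)
  have h3 : (r / 2) ^ 2 * b ≤ (r / 2) ^ 2 * η := by nlinarith
  have := le_of_mul_le_mul_left h3 (by positivity)
  linarith

theorem max_cond {g k : V → ℝ} {x y P Px Py : V} {Z X Y : V →L[ℝ] V} {τ ρ : ℝ} (hτ : 0 < τ)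
    (hτ1 : τ < 1) (hg : Twice g ((1 / 2 : ℝ) • (x + y)) P Z) (hx : Twice k x Px X)
    (hy : Twice k y Py Y) (p : V × V →L[ℝ] ℝ) (hp : ‖p‖ ≤ ρ)
    (hmax : ∀ x' y', τ * g ((1 / 2 : ℝ) • (x' + y')) + 1 / 2 * k x' + 1 / 2 * k y' - p (x', y') ≤
      τ * g ((1 / 2 : ℝ) • (x + y)) + 1 / 2 * k x + 1 / 2 * k y - p (x, y)) :
    ‖τ • P + Px‖ ≤ 2 * ρ ∧ ‖τ • P + Py‖ ≤ 2 * ρ ∧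
      ∀ ξ, τ * ⟪Z ξ, ξ⟫ + 1 / 2 * ⟪X ξ, ξ⟫ + 1 / 2 * ⟪Y ξ, ξ⟫ ≤ 0 := by
  have nb : ∀ {a : V} (q : V → ℝ), (∀ ξ, |q ξ| ≤ ρ * ‖ξ‖) → (∀ ξ, ⟪a, ξ⟫ = 2 * q ξ) →
      ‖a‖ ≤ 2 * ρ := by
    intro a q hq ha
    have h1 := ha a
    rw [real_inner_self_eq_norm_sq] at h1
    have h2 := (abs_le.1 (hq a)).2
    rcases eq_or_ne ‖a‖ 0 with h0 | h0
    · rw [h0]; have := (norm_nonneg p).trans hp; linarith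
    · have : 0 < ‖a‖ := lt_of_le_of_ne (norm_nonneg _) (Ne.symm h0)
      nlinarith
  refine ⟨?_, ?_, ?_⟩
  · refine nb (fun ξ => p (ξ, 0)) (fun ξ => ?_) (fun ξ => ?_)
    · have h1 := p.le_opNorm (ξ, 0)
      rw [Prod.norm_mk, norm_zero, max_eq_left (norm_nonneg _), Real.norm_eq_abs] at h1
      exact h1.trans (by gcongr)
    · have h1 := hg.line ((1 / 2 : ℝ) • ξ) (η := 1 / 2) (by norm_num)
      have h2 := hx.line ξ (η := 1 / 2) (by norm_num)
      have h3 : τ * (1 / 2 * ⟪P, ξ⟫) + 1 / 2 * ⟪Px, ξ⟫ - p (ξ, 0) = 0 := by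
        apply first_order (b := τ * (1 / 2 * ⟪Z ((1 / 2 : ℝ) • ξ), (1 / 2 : ℝ) • ξ⟫) +
          1 / 2 * (1 / 2 * ⟪X ξ, ξ⟫))
        filter_upwards [h1, h2] with t h1 h2
        have h4 := hmax (x + t • ξ) y
        have e1 : (1 / 2 : ℝ) • (x + t • ξ + y) = (1 / 2 : ℝ) • (x + y) + t • ((1 / 2 : ℝ) • ξ) := by
          module
        have e2 : ((x + t • ξ, y) : V × V) = (x, y) + t • (ξ, (0 : V)) := by simp
        rw [e1, e2, map_add, map_smul, smul_eq_mul] at h4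
        rw [inner_smul_right P ξ] at h1
        have h1' := (abs_le.1 h1).1
        have h2' := (abs_le.1 h2).1
        nlinarith [sq_nonneg t]
      rw [inner_add_left, real_inner_smul_left]
      linarith
  · refine nb (fun ξ => p (0, ξ)) (fun ξ => ?_) (fun ξ => ?_)
    · have h1 := p.le_opNorm (0, ξ)
      rw [Prod.norm_mk, norm_zero, max_eq_right (norm_nonneg _), Real.norm_eq_abs] at h1
      exact h1.trans (by gcongr)
    · have h1 := hg.line ((1 / 2 : ℝ) • ξ) (η := 1 / 2) (by norm_num)
      have h2 := hy.line ξ (η := 1 / 2) (by norm_num)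
      have h3 : τ * (1 / 2 * ⟪P, ξ⟫) + 1 / 2 * ⟪Py, ξ⟫ - p (0, ξ) = 0 := by
        apply first_order (b := τ * (1 / 2 * ⟪Z ((1 / 2 : ℝ) • ξ), (1 / 2 : ℝ) • ξ⟫) +
          1 / 2 * (1 / 2 * ⟪Y ξ, ξ⟫))
        filter_upwards [h1, h2] with t h1 h2
        have h4 := hmax x (y + t • ξ)
        have e1 : (1 / 2 : ℝ) • (x + (y + t • ξ)) = (1 / 2 : ℝ) • (x + y) + t • ((1 / 2 : ℝ) • ξ) := by
          module
        have e2 : ((x, y + t • ξ) : V × V) = (x, y) + t • ((0 : V), ξ) := by simp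
        rw [e1, e2, map_add, map_smul, smul_eq_mul] at h4
        rw [inner_smul_right P ξ] at h1
        have h1' := (abs_le.1 h1).1
        have h2' := (abs_le.1 h2).1
        nlinarith [sq_nonneg t]
      rw [inner_add_left, real_inner_smul_left]
      linarith
  · intro ξ
    have h3 : τ * (1 / 2 * ⟪Z ξ, ξ⟫) + 1 / 2 * (1 / 2 * ⟪X ξ, ξ⟫) + 1 / 2 * (1 / 2 * ⟪Y ξ, ξ⟫) ≤ 0 := by
      apply second_order (a := τ * ⟪P, ξ⟫ + 1 / 2 * ⟪Px, ξ⟫ + 1 / 2 * ⟪Py, ξ⟫ - p (ξ, ξ))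
      intro η hη
      filter_upwards [hg.line ξ (half_pos hη), hx.line ξ (half_pos hη), hy.line ξ (half_pos hη)]
        with t h1 h2 h5
      have h4 := hmax (x + t • ξ) (y + t • ξ)
      have e1 : (1 / 2 : ℝ) • (x + t • ξ + (y + t • ξ)) = (1 / 2 : ℝ) • (x + y) + t • ξ := by
        module
      have e2 : ((x + t • ξ, y + t • ξ) : V × V) = (x, y) + t • (ξ, ξ) := by simp
      rw [e1, e2, map_add, map_smul, smul_eq_mul] at h4
      have h1' := (abs_le.1 h1).1
      have h2' := (abs_le.1 h2).1
      have h5' := (abs_le.1 h5).1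
      have h6 := mul_le_mul_of_nonneg_left h1' hτ.le
      have h7 : 0 ≤ η / 2 * t ^ 2 := by positivity
      nlinarith
    linarith

theorem good_point [MeasurableSpace V] [BorelSpace V] {ε : ℝ} (hε : 0 < ε) {u u' g k : V → ℝ}
    {m m' : V → V} (hg : SupConv ε u g m) (hk : SupConv ε u' k m') {τ ρ Cw : ℝ} (hτ : 0 < τ)
    (hτ1 : τ < 1) (hρ : 0 < ρ)
    (hW : ∀ x y, τ * g ((1 / 2 : ℝ) • (x + y)) + 1 / 2 * k x + 1 / 2 * k y ≤
      Cw - 2 * ρ * ‖((x, y) : V × V)‖) :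
    ∃ (x y : V) (p : V × V →L[ℝ] ℝ), ‖p‖ ≤ ρ ∧
      (∃ P Z, Twice g ((1 / 2 : ℝ) • (x + y)) P Z) ∧ (∃ P Z, Twice k x P Z) ∧
      (∃ P Z, Twice k y P Z) ∧
      ∀ x' y', τ * g ((1 / 2 : ℝ) • (x' + y')) + 1 / 2 * k x' + 1 / 2 * k y' - p (x', y') ≤
      τ * g ((1 / 2 : ℝ) • (x + y)) + 1 / 2 * k x + 1 / 2 * k y - p (x, y) := by
  set W : V × V → ℝ := fun v => τ * g ((1 / 2 : ℝ) • (v.1 + v.2)) + 1 / 2 * k v.1 + 1 / 2 * k v.2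
    with hWdef
  have hgc := hg.continuous
  have hkc := hk.continuous
  have hWc : Continuous W := by fun_prop
  have hmax : ∀ p : V × V →L[ℝ] ℝ, ‖p‖ ≤ ρ → ∃ v, ∀ v', W v' - p v' ≤ W v - p v := by
    intro p hp
    have hc : Continuous (fun v => W v - p v) := by fun_prop
    have := hc.exists_forall_ge' 0 (by
      have hco := (isCompact_closedBall (0 : V × V) ((Cw - W 0) / ρ)).compl_mem_cocompact
      filter_upwards [hco] with v hv
      simp only [Set.mem_compl_iff, mem_closedBall_zero_iff, not_le] at hv
      rw [div_lt_iff₀ hρ] at hv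
      have h1 := hW v.1 v.2
      have h2 := (abs_le.1 ((Real.norm_eq_abs (p v)) ▸ p.le_opNorm v)).1
      have h3 : ‖p‖ * ‖v‖ ≤ ρ * ‖v‖ := by gcongr
      have h4 : W v ≤ Cw - 2 * ρ * ‖v‖ := h1
      rw [map_zero]
      linarith)
    exact this
  have hK : ∀ v0, ∃ l : V × V →L[ℝ] ℝ, ∀ v, W v0 + l (v - v0) - 1 / ε * ‖v - v0‖ ^ 2 ≤ W v := by
    intro v0
    set z0 := (1 / 2 : ℝ) • (v0.1 + v0.2) with hz0
    set fs := ContinuousLinearMap.fst ℝ V V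
    set sn := ContinuousLinearMap.snd ℝ V V
    refine ⟨(τ * (1 / ε) * (1 / 2)) • (innerSL ℝ (m z0 - z0)).comp (fs + sn) +
      (1 / 2 * (1 / ε)) • (innerSL ℝ (m' v0.1 - v0.1)).comp fs +
      (1 / 2 * (1 / ε)) • (innerSL ℝ (m' v0.2 - v0.2)).comp sn, fun v => ?_⟩
    have h1 := hg.lower z0 ((1 / 2 : ℝ) • (v.1 + v.2))
    have h2 := hk.lower v0.1 v.1
    have h3 := hk.lower v0.2 v.2
    have n1 : ‖v.1 - v0.1‖ ≤ ‖v - v0‖ := norm_fst_le (v - v0)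
    have n2 : ‖v.2 - v0.2‖ ≤ ‖v - v0‖ := norm_snd_le (v - v0)
    have e1 : (1 / 2 : ℝ) • (v.1 + v.2) - z0 =
        (1 / 2 : ℝ) • ((v.1 - v0.1) + (v.2 - v0.2)) := by rw [hz0]; module
    have n3 : ‖(1 / 2 : ℝ) • (v.1 + v.2) - z0‖ ≤ ‖v - v0‖ := by
      rw [e1, norm_smul, Real.norm_of_nonneg (by norm_num)]
      have := norm_add_le (v.1 - v0.1) (v.2 - v0.2)
      linarith
    have s1 : ‖v.1 - v0.1‖ ^ 2 ≤ ‖v - v0‖ ^ 2 := by gcongr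
    have s2 : ‖v.2 - v0.2‖ ^ 2 ≤ ‖v - v0‖ ^ 2 := by gcongr
    have s3 : ‖(1 / 2 : ℝ) • (v.1 + v.2) - z0‖ ^ 2 ≤ ‖v - v0‖ ^ 2 := by gcongr
    rw [e1, inner_smul_right] at h1
    rw [← e1] at h1
    have hc : 0 < 1 / (2 * ε) := by positivity
    have r1 := mul_le_mul_of_nonneg_left s1 hc.le
    have r2 := mul_le_mul_of_nonneg_left s2 hc.le
    have r3 := mul_le_mul_of_nonneg_left s3 hc.le
    have r0 : 0 ≤ 1 / (2 * ε) * ‖v - v0‖ ^ 2 := by positivity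
    have e : 1 / ε = 2 * (1 / (2 * ε)) := by field_simp
    have h1' : g z0 + 1 / ε * (1 / 2 * ⟪m z0 - z0, v.1 - v0.1 + (v.2 - v0.2)⟫) -
      1 / (2 * ε) * ‖v - v0‖ ^ 2 ≤ g ((1 / 2 : ℝ) • (v.1 + v.2)) := by linarith
    have h1'' := mul_le_mul_of_nonneg_left h1' hτ.le
    have r4 : τ * (1 / (2 * ε) * ‖v - v0‖ ^ 2) ≤ 1 / (2 * ε) * ‖v - v0‖ ^ 2 :=
      mul_le_of_le_one_left r0 hτ1.le
    simp only [add_apply, smul_apply, ContinuousLinearMap.comp_apply, innerSL_apply_apply, hWdef, fs, sn,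
      ContinuousLinearMap.coe_fst', ContinuousLinearMap.coe_snd', Prod.fst_sub, Prod.snd_sub,
      smul_eq_mul]
    have e4 : 1 / ε * ‖v - v0‖ ^ 2 = 2 * (1 / (2 * ε) * ‖v - v0‖ ^ 2) := by rw [e]; ring
    rw [e4]
    linarith
  have hHaar : (MeasureTheory.volume : MeasureTheory.Measure (V × V)).IsAddHaarMeasure :=
    inferInstanceAs ((MeasureTheory.volume : MeasureTheory.Measure V).prod
      (MeasureTheory.volume : MeasureTheory.Measure V)).IsAddHaarMeasure
  have a1 : ∀ᵐ v : V × V, ∃ P Z, Twice g ((1 / 2 : ℝ) • (v.1 + v.2)) P Z := by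
    refine ae_lin _ _ ((1 / 2 : ℝ) • (LinearMap.fst ℝ V V + LinearMap.snd ℝ V V)) ?_ hg.twice
    intro z
    refine ⟨(z, z), ?_⟩
    simp only [LinearMap.smul_apply, LinearMap.add_apply, LinearMap.fst_apply, LinearMap.snd_apply]
    module
  have a2 : ∀ᵐ v : V × V, ∃ P Z, Twice k v.1 P Z :=
    ae_lin _ _ (LinearMap.fst ℝ V V) (fun z => ⟨(z, z), rfl⟩) hk.twice
  have a3 : ∀ᵐ v : V × V, ∃ P Z, Twice k v.2 P Z :=
    ae_lin _ _ (LinearMap.snd ℝ V V) (fun z => ⟨(z, z), rfl⟩) hk.twice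
  have a4 := a1.and (a2.and a3)
  obtain ⟨v, hv, p, hp, hpm⟩ := jensen (MeasureTheory.volume : MeasureTheory.Measure (V × V))
    (W := W) (K := 1 / ε) (by positivity) hρ hK hmax _ a4
  have hv' : (∃ P Z, Twice g ((1 / 2 : ℝ) • (v.1 + v.2)) P Z) ∧ (∃ P Z, Twice k v.1 P Z) ∧
      (∃ P Z, Twice k v.2 P Z) := not_not.1 hv
  exact ⟨v.1, v.2, p, hp, hv'.1, hv'.2.1, hv'.2.2, fun x' y' => hpm (x', y')⟩

end SupConvolution

open scoped RealInnerProductSpace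
open Filter

section Convexity
variable {n : ℕ}

theorem thick {H : EuclideanSpace ℝ (Fin n) → ℝ} (hH : Continuous H)
    {S : Set (EuclideanSpace ℝ (Fin n))} (hS : IsCompact S) (hneg : ∀ q ∈ S, H q < 0) :
    ∃ ρ : ℝ, 0 < ρ ∧ ∀ q ∈ S, ∀ e, ‖e‖ ≤ ρ → H (q + e) < 0 := by
  obtain ⟨ρ, hρ, h⟩ := hS.exists_cthickening_subset_open
    (isOpen_lt hH continuous_const : IsOpen {q | H q < 0}) hneg
  refine ⟨ρ, hρ, fun q hq e he => ?_⟩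
  refine h (Metric.mem_cthickening_of_dist_le _ q _ _ hq ?_)
  simpa [dist_eq_norm] using he

theorem H_shrink {H : EuclideanSpace ℝ (Fin n) → ℝ} (hH : Continuous H) (hH0 : H 0 < 0)
    (hKcpt : IsCompact {p : EuclideanSpace ℝ (Fin n) | H p ≤ 0}) (hHconv : ConvexOn ℝ Set.univ H)
    {τ : ℝ} (hτ : 0 < τ) (hτ1 : τ < 1) :
    ∃ ρ : ℝ, 0 < ρ ∧ ∀ P, H P ≤ 0 → ∀ e, ‖e‖ ≤ ρ → H (τ • P + e) < 0 := by
  have hS : IsCompact ((fun P => τ • P) '' {p : EuclideanSpace ℝ (Fin n) | H p ≤ 0}) :=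
    hKcpt.image (by fun_prop)
  obtain ⟨ρ, hρ, h⟩ := thick hH hS (by
    rintro _ ⟨P, hP, rfl⟩
    have h1 := hHconv.2 (Set.mem_univ P) (Set.mem_univ 0) hτ.le (by linarith : 0 ≤ 1 - τ) (by ring)
    simp only [smul_zero, add_zero, smul_eq_mul] at h1
    have h2 : τ * H P ≤ 0 := mul_nonpos_of_nonneg_of_nonpos hτ.le hP
    have h3 : (1 - τ) * H 0 < 0 := mul_neg_of_pos_of_neg (by linarith) hH0
    show H (τ • P) < 0
    linarith)
  exact ⟨ρ, hρ, fun P hP e he => h _ ⟨P, hP, rfl⟩ e he⟩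

theorem ell_facts {H ℓ : EuclideanSpace ℝ (Fin n) → ℝ} (hH : Continuous H) (hH0 : H 0 < 0)
    (hKcpt : IsCompact {p : EuclideanSpace ℝ (Fin n) | H p ≤ 0})
    (hℓ : ∀ v, IsGreatest {r : ℝ | ∃ p, H p ≤ 0 ∧ ⟪p, v⟫ = r} (ℓ v)) :
    ∃ c L : ℝ, 0 < c ∧ 0 < L ∧ (∀ x, c * ‖x‖ ≤ ℓ x) ∧ (∀ x, ℓ x ≤ L * ‖x‖) ∧
      (∀ w z, ℓ w ≤ ℓ z + L * ‖w - z‖) ∧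
      (∀ x y, ℓ ((1 / 2 : ℝ) • (x + y)) ≤ 1 / 2 * (ℓ x + ℓ y)) ∧
      (∀ p, H p ≤ 0 → ‖p‖ ≤ L) := by
  have hle : ∀ p v, H p ≤ 0 → ⟪p, v⟫ ≤ ℓ v := fun p v hp => (hℓ v).2 ⟨p, hp, rfl⟩
  obtain ⟨ρ, hρ, hρH⟩ := thick hH (isCompact_singleton (x := (0 : EuclideanSpace ℝ (Fin n))))
    (by simpa using hH0)
  obtain ⟨L0, hL0⟩ := hKcpt.isBounded.exists_norm_le
  have hL : ∀ p, H p ≤ 0 → ‖p‖ ≤ max L0 1 := fun p hp => (hL0 p hp).trans (le_max_left _ _)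
  have hcs : ∀ p v, H p ≤ 0 → ⟪p, v⟫ ≤ max L0 1 * ‖v‖ := fun p v hp =>
    (real_inner_le_norm p v).trans (by gcongr; exact hL p hp)
  refine ⟨ρ, max L0 1, hρ, by positivity, ?_, ?_, ?_, ?_, hL⟩
  · intro x
    rcases eq_or_ne x 0 with rfl | hx
    · have := hle 0 (0 : EuclideanSpace ℝ (Fin n)) hH0.le
      simpa using this
    · have hx' : 0 < ‖x‖ := norm_pos_iff.2 hx
      have h1 := hρH 0 rfl ((ρ / ‖x‖) • x) (by
        rw [norm_smul, Real.norm_of_nonneg (by positivity), div_mul_cancel₀ _ hx'.ne'])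
      rw [zero_add] at h1
      have h2 := hle _ x h1.le
      rw [real_inner_smul_left, real_inner_self_eq_norm_sq] at h2
      have : ρ / ‖x‖ * ‖x‖ ^ 2 = ρ * ‖x‖ := by field_simp
      linarith
  · intro x
    obtain ⟨p, hp, hpx⟩ := (hℓ x).1
    rw [← hpx]
    exact hcs p x hp
  · intro w z
    obtain ⟨p, hp, hpx⟩ := (hℓ w).1
    have h1 := hle p z hp
    have h2 := hcs p (w - z) hp
    rw [inner_sub_right] at h2
    linarith
  · intro x y
    obtain ⟨p, hp, hpx⟩ := (hℓ ((1 / 2 : ℝ) • (x + y))).1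
    rw [inner_smul_right, inner_add_right] at hpx
    have h1 := hle p x hp
    have h2 := hle p y hp
    linarith

theorem growth_bound {ℓ u : EuclideanSpace ℝ (Fin n) → ℝ} {c L : ℝ} (hc : 0 < c)
    (h1 : ∀ x, c * ‖x‖ ≤ ℓ x) (hlip : ∀ w z, ℓ w ≤ ℓ z + L * ‖w - z‖) (hu : Continuous u)
    (hg : Tendsto (fun x => u x / ℓ x) (cocompact (EuclideanSpace ℝ (Fin n))) (nhds 1))
    {a : ℝ} (ha : 0 < a) : ∃ C : ℝ, 0 ≤ C ∧ ∀ x, |u x - ℓ x| ≤ a * ℓ x + C := by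
  have hℓc : Continuous ℓ := by
    have : LipschitzWith (Real.toNNReal L) ℓ := by
      apply LipschitzWith.of_dist_le_mul
      intro x y
      rw [Real.dist_eq, dist_eq_norm, abs_le]
      have a1 := hlip x y
      have a2 := hlip y x
      rw [norm_sub_rev] at a2
      have a3 : L * ‖x - y‖ ≤ (Real.toNNReal L : ℝ) * ‖x - y‖ := by
        gcongr; exact Real.le_coe_toNNReal L
      constructor <;> linarith
    exact this.continuous
  have hev : ∀ᶠ x in cocompact (EuclideanSpace ℝ (Fin n)), |u x - ℓ x| ≤ a * ℓ x := by
    have h2 := hg.eventually (Metric.ball_mem_nhds 1 ha)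
    filter_upwards [h2, ev_cocompact (0 : EuclideanSpace ℝ (Fin n)) 0] with x hx hx0
    rw [sub_zero] at hx0
    have hℓ0 : 0 < ℓ x := lt_of_lt_of_le (by positivity) (h1 x)
    rw [Real.dist_eq] at hx
    have e : u x - ℓ x = (u x / ℓ x - 1) * ℓ x := by field_simp
    rw [e, abs_mul, abs_of_pos hℓ0]
    gcongr
  obtain ⟨S, hS, hSc⟩ := mem_cocompact.1 hev
  have hcont : Continuous (fun x => u x - ℓ x) := hu.sub hℓc
  obtain ⟨C, hC⟩ := hS.exists_bound_of_continuousOn hcont.continuousOn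
  refine ⟨max C 0, le_max_right _ _, fun x => ?_⟩
  by_cases hx : x ∈ S
  · have := hC x hx
    rw [Real.norm_eq_abs] at this
    have h0 : 0 ≤ a * ℓ x := mul_nonneg ha.le (le_trans (by positivity) (h1 x))
    have := le_max_left C 0
    linarith
  · have h3 : |u x - ℓ x| ≤ a * ℓ x := hSc hx
    have := le_max_right C 0
    linarith

theorem linear_growth {ℓ u : EuclideanSpace ℝ (Fin n) → ℝ} {L C : ℝ} (hL : 0 < L) (hC : 0 ≤ C)
    (h2 : ∀ x, ℓ x ≤ L * ‖x‖) (h0 : ∀ x, 0 ≤ ℓ x)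
    (h : ∀ x, |u x - ℓ x| ≤ 1 * ℓ x + C) : ∃ A, 0 ≤ A ∧ ∀ x, |u x| ≤ A + A * ‖x‖ := by
  refine ⟨C + 2 * L, by positivity, fun x => ?_⟩
  have a1 := abs_le.1 (h x)
  have a2 := h2 x
  have a3 := h0 x
  have a4 : 0 ≤ C * ‖x‖ := by positivity
  rw [abs_le]
  constructor <;> nlinarith [norm_nonneg x]

theorem f_lower {f : EuclideanSpace ℝ (Fin n) → ℝ} (hf : ConvexOn ℝ Set.univ f)
    (hfsl : Tendsto (fun x => f x / ‖x‖) (cocompact (EuclideanSpace ℝ (Fin n))) atTop) (A : ℝ) :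
    ∃ M, 0 ≤ M ∧ ∀ x, A * ‖x‖ - M ≤ f x := by
  have hfc : Continuous f := hf.locallyLipschitz.continuous
  have hev := hfsl.eventually_ge_atTop A
  obtain ⟨S, hS, hSc⟩ := mem_cocompact.1 hev
  have hcont : Continuous (fun x => A * ‖x‖ - f x) := by fun_prop
  obtain ⟨C, hC⟩ := hS.exists_bound_of_continuousOn hcont.continuousOn
  refine ⟨max C |f 0|, by positivity, fun x => ?_⟩
  by_cases hx : x ∈ S
  · have := hC x hx
    rw [Real.norm_eq_abs] at this
    have h1 := (abs_le.1 this).2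
    have := le_max_left C |f 0|
    linarith
  · have h3 : A ≤ f x / ‖x‖ := hSc hx
    have h4 := le_max_right C |f 0|
    rcases eq_or_ne x 0 with rfl | h0
    · have := neg_abs_le (f 0)
      simp only [norm_zero, mul_zero]
      linarith
    · have hp : 0 < ‖x‖ := norm_pos_iff.2 h0
      rw [le_div_iff₀ hp] at h3
      have := abs_nonneg (f 0)
      linarith

theorem F_key {θ Θ : ℝ} (hθ : 0 < θ) (hθΘ : θ ≤ Θ) {F : Matrix (Fin n) (Fin n) ℝ → ℝ}
    (hFell : ∀ M N : Matrix (Fin n) (Fin n) ℝ, M.IsSymm → N.PosSemidef →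
      -Θ * N.trace ≤ F (M + N) - F M ∧ F (M + N) - F M ≤ -θ * N.trace)
    (hFhom : ∀ t : ℝ, 0 ≤ t → ∀ M : Matrix (Fin n) (Fin n) ℝ, M.IsSymm →
      F (t • M) = t * F M)
    (hFsadd : ∀ M N : Matrix (Fin n) (Fin n) ℝ, M.IsSymm → N.IsSymm →
      F M + F N ≤ F (M + N))
    {X Y Z : EuclideanSpace ℝ (Fin n) →L[ℝ] EuclideanSpace ℝ (Fin n)} {τ η : ℝ} (hτ : 0 < τ)
    (hτ1 : τ < 1) (hη : 0 < η)
    (h : ∀ ξ, τ * ⟪Z ξ, ξ⟫ + 1 / 2 * ⟪X ξ, ξ⟫ + 1 / 2 * ⟪Y ξ, ξ⟫ ≤ 0) :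
    F (Mat (-(X + (2 * η) • ContinuousLinearMap.id ℝ _))) +
      F (Mat (-(Y + (2 * η) • ContinuousLinearMap.id ℝ _))) ≤
      2 * τ * F (Mat (Z + (2 * η) • ContinuousLinearMap.id ℝ _)) + 8 * Θ * n * η := by
  set I := ContinuousLinearMap.id ℝ (EuclideanSpace ℝ (Fin n)) with hI
  have hIpsd : (Mat I).PosSemidef := Mat_psd _ fun v => by
    rw [hI, ContinuousLinearMap.id_apply]; exact real_inner_self_nonneg
  have h1 := hFsadd _ _ (Mat_symm (-(X + (2 * η) • I))) (Mat_symm (-(Y + (2 * η) • I)))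
  rw [← Mat_add] at h1
  set M0 := -(X + (2 * η) • I) + -(Y + (2 * η) • I) with hM0
  set D := -X - Y - (2 * τ) • Z with hD
  have hDpsd : (Mat D).PosSemidef := Mat_psd _ fun v => by
    have := h v
    simp only [hD, sub_apply, neg_apply, smul_apply, inner_sub_left, inner_neg_left,
      real_inner_smul_left]
    linarith
  have e1 : Mat M0 + Mat ((4 * τ * η + 4 * η) • I) =
      (2 * τ) • Mat (Z + (2 * η) • I) + Mat D := by
    rw [← Mat_add, ← Mat_smul, ← Mat_add, hM0, hD]
    congr 1
    module
  have hNpsd : (Mat ((4 * τ * η + 4 * η) • I)).PosSemidef := by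
    rw [Mat_smul]; exact hIpsd.smul (by positivity)
  have h2 := (hFell (Mat M0) _ (Mat_symm _) hNpsd).1
  have hsym : ((2 * τ) • Mat (Z + (2 * η) • I)).IsSymm := by rw [← Mat_smul]; exact Mat_symm _
  have h3 := (hFell _ _ hsym hDpsd).2
  rw [e1, Mat_smul, Matrix.trace_smul, Mat_id_trace, smul_eq_mul] at h2
  rw [hFhom _ (by positivity) _ (Mat_symm _)] at h3
  have h4 : 0 ≤ θ * (Mat D).trace := mul_nonneg hθ.le hDpsd.trace_nonneg
  have h5 : (4 * τ * η + 4 * η) * n ≤ 8 * n * η := by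
    have : (n : ℝ) * η * τ ≤ n * η := mul_le_of_le_one_right (by positivity) hτ1.le
    nlinarith
  have h6 := mul_le_mul_of_nonneg_left h5 (hθ.le.trans hθΘ)
  linarith

end Convexity

open scoped RealInnerProductSpace
open Filter

section Midconvex
variable {n : ℕ}

theorem unif_cont_ball {f : EuclideanSpace ℝ (Fin n) → ℝ} (hf : Continuous f) (R : ℝ) {ω : ℝ}
    (hω : 0 < ω) : ∃ r : ℝ, 0 < r ∧ ∀ x w, ‖x‖ ≤ R → ‖w - x‖ < r → |f w - f x| < ω := by
  have hc := (isCompact_closedBall (0 : EuclideanSpace ℝ (Fin n)) (R + 1)).uniformContinuousOn_of_continuous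
    hf.continuousOn
  rw [Metric.uniformContinuousOn_iff] at hc
  obtain ⟨r, hr, h⟩ := hc ω hω
  refine ⟨min r 1, by positivity, fun x w hx hw => ?_⟩
  have h1 := lt_of_lt_of_le hw (min_le_left _ _)
  have h2 := lt_of_lt_of_le hw (min_le_right _ _)
  have h3 := h w (by
    rw [mem_closedBall_zero_iff]
    have := norm_add_le (w - x) x
    rw [sub_add_cancel] at this
    linarith) x (by rw [mem_closedBall_zero_iff]; linarith) (by rwa [dist_eq_norm])
  rwa [Real.dist_eq] at h3

set_option maxHeartbeats 4000000 in
theorem midconvex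
    (θ Θ : ℝ) (hθ : 0 < θ) (hθΘ : θ ≤ Θ)
    (F : Matrix (Fin n) (Fin n) ℝ → ℝ)
    (hFell : ∀ M N : Matrix (Fin n) (Fin n) ℝ, M.IsSymm → N.PosSemidef →
      -Θ * N.trace ≤ F (M + N) - F M ∧ F (M + N) - F M ≤ -θ * N.trace)
    (hFhom : ∀ t : ℝ, 0 ≤ t → ∀ M : Matrix (Fin n) (Fin n) ℝ, M.IsSymm →
      F (t • M) = t * F M)
    (hFsadd : ∀ M N : Matrix (Fin n) (Fin n) ℝ, M.IsSymm → N.IsSymm →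
      F M + F N ≤ F (M + N))
    (H ℓ : EuclideanSpace ℝ (Fin n) → ℝ)
    (hH : Continuous H) (hH0 : H 0 < 0)
    (hKcpt : IsCompact {p : EuclideanSpace ℝ (Fin n) | H p ≤ 0})
    (hHconv : ConvexOn ℝ Set.univ H)
    (hℓ : ∀ v, IsGreatest {r : ℝ | ∃ p, H p ≤ 0 ∧ ⟪p, v⟫ = r} (ℓ v))
    (f : EuclideanSpace ℝ (Fin n) → ℝ)
    (hf : ConvexOn ℝ Set.univ f)
    (hfsl : Tendsto (fun x => f x / ‖x‖) (cocompact (EuclideanSpace ℝ (Fin n))) atTop)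
    (δ : ℝ) (hδ : 0 < δ) (u : EuclideanSpace ℝ (Fin n) → ℝ) (hu : Continuous u)
    (hsub : IsSubsolutionDisc F H f δ u) (hsup : IsSupersolutionDisc F H f δ u)
    (hgr : Tendsto (fun x => u x / ℓ x) (cocompact (EuclideanSpace ℝ (Fin n))) (nhds 1))
    (x₀ y₀ : EuclideanSpace ℝ (Fin n)) :
    u ((1 / 2 : ℝ) • (x₀ + y₀)) ≤ 1 / 2 * (u x₀ + u y₀) := by
  obtain ⟨c, L, hc, hL, hlow, hup, hlip, hmid, -⟩ := ell_facts hH hH0 hKcpt hℓ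
  have hℓ0 : ∀ x, 0 ≤ ℓ x := fun x => le_trans (by positivity) (hlow x)
  have hfc : Continuous f := hf.locallyLipschitz.continuous
  have hΘ : 0 ≤ Θ := hθ.le.trans hθΘ
  by_contra hcon
  push Not at hcon
  set z₀ := (1 / 2 : ℝ) • (x₀ + y₀) with hz₀
  obtain ⟨κ, hκ⟩ : ∃ κ, κ = u z₀ - 1 / 2 * (u x₀ + u y₀) := ⟨_, rfl⟩
  have hκ0 : 0 < κ := by linarith
  obtain ⟨Mf, hMf0, hMf⟩ := f_lower hf hfsl 0
  -- the parameter `s = 1 - τ`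
  obtain ⟨s, hs0, hs1, hs2, hs3⟩ : ∃ s : ℝ, 0 < s ∧ s ≤ 1 / 2 ∧ s * |u z₀| ≤ κ / 2 ∧
      s * Mf ≤ δ * κ / 16 := by
    refine ⟨min (1 / 2) (min (κ / (2 * (|u z₀| + 1))) (δ * κ / (16 * (Mf + 1)))), by positivity,
      min_le_left _ _, ?_, ?_⟩
    · calc _ ≤ κ / (2 * (|u z₀| + 1)) * |u z₀| := by
            gcongr; exact (min_le_right _ _).trans (min_le_left _ _)
        _ ≤ κ / (2 * (|u z₀| + 1)) * (|u z₀| + 1) := by gcongr; linarith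
        _ = κ / 2 := by field_simp
    · calc _ ≤ δ * κ / (16 * (Mf + 1)) * Mf := by
            gcongr; exact (min_le_right _ _).trans (min_le_right _ _)
        _ ≤ δ * κ / (16 * (Mf + 1)) * (Mf + 1) := by gcongr; linarith
        _ = δ * κ / 16 := by field_simp
  obtain ⟨τ, hτs⟩ : ∃ τ, τ = 1 - s := ⟨_, rfl⟩
  have hτ : 0 < τ := by linarith
  have hτ1 : τ < 1 := by linarith
  obtain ⟨C, hC0, hC⟩ := growth_bound hc hlow hlip hu hgr (a := s / 4) (by positivity)
  obtain ⟨A, hA0, hA⟩ : ∃ A, 0 ≤ A ∧ ∀ x, |u x| ≤ A + A * ‖x‖ := by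
    refine linear_growth hL hC0 hup hℓ0 fun x => (hC x).trans ?_
    nlinarith [hℓ0 x]
  have hA' : ∀ x, |(-u) x| ≤ A + A * ‖x‖ := fun x => by simpa using hA x
  obtain ⟨Λ, hΛ⟩ : ∃ Λ, Λ = (1 + s / 4) * L := ⟨_, rfl⟩
  obtain ⟨C1, hC1⟩ : ∃ C1, C1 = C + Λ ^ 2 / 2 := ⟨_, rfl⟩
  have hC10 : 0 ≤ C1 := by rw [hC1]; positivity
  obtain ⟨ρ₀, hρ₀⟩ : ∃ ρ₀, ρ₀ = s * c / 8 := ⟨_, rfl⟩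
  have hρ₀0 : 0 < ρ₀ := by rw [hρ₀]; positivity
  obtain ⟨Cw, hCw⟩ : ∃ Cw, Cw = 2 * C1 := ⟨_, rfl⟩
  obtain ⟨R, hR⟩ : ∃ R, R = (Cw + s * |u 0|) / ρ₀ := ⟨_, rfl⟩
  have hR0 : 0 ≤ R := by rw [hR, hCw]; positivity
  obtain ⟨ρ₁, hρ₁, hρ₁H⟩ := H_shrink hH hH0 hKcpt hHconv hτ hτ1
  obtain ⟨b, hb⟩ : ∃ b, b = ‖((x₀, y₀) : EuclideanSpace ℝ (Fin n) × EuclideanSpace ℝ (Fin n))‖ :=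
    ⟨_, rfl⟩
  have hb0 : 0 ≤ b := by rw [hb]; positivity
  obtain ⟨ρ, hρ, hρa, hρb, hρc⟩ : ∃ ρ : ℝ, 0 < ρ ∧ ρ ≤ ρ₀ ∧ 2 * ρ ≤ ρ₁ ∧ ρ * (R + b) ≤ κ / 4 := by
    refine ⟨min ρ₀ (min (ρ₁ / 2) (κ / (4 * (R + b + 1)))), by positivity, min_le_left _ _, ?_, ?_⟩
    · have := (min_le_right ρ₀ (min (ρ₁ / 2) (κ / (4 * (R + b + 1))))).trans (min_le_left _ _)
      linarith
    · calc _ ≤ κ / (4 * (R + b + 1)) * (R + b) :=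
            mul_le_mul_of_nonneg_right ((min_le_right _ _).trans (min_le_right _ _)) (by positivity)
        _ ≤ κ / (4 * (R + b + 1)) * (R + b + 1) :=
            mul_le_mul_of_nonneg_left (by linarith) (by positivity)
        _ = κ / 4 := by field_simp
  obtain ⟨M1, hM10, hM1⟩ := SupConv.dist hA0 hA R hR0
  obtain ⟨M2, hM20, hM2⟩ := SupConv.dist hA0 hA' R hR0
  obtain ⟨ω, hω⟩ : ∃ ω, ω = δ * κ / 32 := ⟨_, rfl⟩
  have hω0 : 0 < ω := by rw [hω]; positivity
  obtain ⟨r, hr, hfr⟩ := unif_cont_ball hfc R hω0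
  obtain ⟨ε, hε, hε1, hεa⟩ : ∃ ε : ℝ, 0 < ε ∧ ε ≤ 1 ∧ ε * (M1 + M2) < r ^ 2 := by
    refine ⟨min 1 (r ^ 2 / (M1 + M2 + 1)), by positivity, min_le_left _ _, ?_⟩
    calc _ ≤ r ^ 2 / (M1 + M2 + 1) * (M1 + M2) :=
          mul_le_mul_of_nonneg_right (min_le_right _ _) (by positivity)
      _ < r ^ 2 / (M1 + M2 + 1) * (M1 + M2 + 1) :=
          mul_lt_mul_of_pos_left (by linarith) (by positivity)
      _ = r ^ 2 := by field_simp
  obtain ⟨η, hη, hηa⟩ : ∃ η : ℝ, 0 < η ∧ 4 * Θ * n * η ≤ δ * κ / 32 := by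
    refine ⟨δ * κ / (128 * (Θ * n + 1)), by positivity, ?_⟩
    have : δ * κ / (128 * (Θ * n + 1)) * (Θ * n + 1) = δ * κ / 128 := by field_simp
    have h2 : 0 < δ * κ / (128 * (Θ * n + 1)) := by positivity
    linarith
  obtain ⟨g, m, hg⟩ := supConv_exists hu hA0 (fun z => (le_abs_self _).trans (hA z)) hε
  obtain ⟨k, m', hk⟩ := supConv_exists hu.neg hA0 (fun z => (le_abs_self _).trans (hA' z)) hε
  have hgu : ∀ z, g z ≤ (1 + s / 4) * ℓ z + C1 := by
    intro z
    have := hg.growth hε hε1 (ψ := fun w => (1 + s / 4) * ℓ w) (C := C) (Λ := Λ)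
      (fun w => by have := (abs_le.1 (hC w)).2; linarith)
      (fun w z => by
        have := mul_le_mul_of_nonneg_left (hlip w z) (by positivity : 0 ≤ 1 + s / 4)
        rw [hΛ]; linarith) z
    rw [hC1]; linarith
  have hku : ∀ z, k z ≤ -(1 - s / 4) * ℓ z + C1 := by
    intro z
    have := hk.growth hε hε1 (ψ := fun w => -(1 - s / 4) * ℓ w) (C := C) (Λ := Λ)
      (fun w => by
        have := (abs_le.1 (hC w)).1
        simp only [Pi.neg_apply]
        linarith)
      (fun w z => by
        have h1 := hlip z w
        rw [norm_sub_rev] at h1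
        have := mul_le_mul_of_nonneg_left h1 (by linarith : 0 ≤ 1 - s / 4)
        have h2 : 0 ≤ L * ‖w - z‖ := by positivity
        have h3 : 0 ≤ s * (L * ‖w - z‖) := by positivity
        rw [hΛ]; linarith) z
    rw [hC1]; linarith
  have hW : ∀ x y, τ * g ((1 / 2 : ℝ) • (x + y)) + 1 / 2 * k x + 1 / 2 * k y ≤
      Cw - 2 * ρ₀ * ‖((x, y) : EuclideanSpace ℝ (Fin n) × EuclideanSpace ℝ (Fin n))‖ := by
    intro x y
    have h1 := hgu ((1 / 2 : ℝ) • (x + y))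
    have h2 := hku x
    have h3 := hku y
    have h4 := mul_le_mul_of_nonneg_left (hmid x y) (by positivity : 0 ≤ 1 + s / 4)
    have h5 : g ((1 / 2 : ℝ) • (x + y)) ≤ (1 + s / 4) * (1 / 2 * (ℓ x + ℓ y)) + C1 := by linarith
    have h6 := mul_le_mul_of_nonneg_left h5 hτ.le
    have h7 : ‖((x, y) : EuclideanSpace ℝ (Fin n) × EuclideanSpace ℝ (Fin n))‖ ≤ ‖x‖ + ‖y‖ := by
      rw [Prod.norm_mk]
      exact max_le (by linarith [norm_nonneg y]) (by linarith [norm_nonneg x])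
    have h8 : c * ‖((x, y) : EuclideanSpace ℝ (Fin n) × EuclideanSpace ℝ (Fin n))‖ ≤ ℓ x + ℓ y := by
      have := mul_le_mul_of_nonneg_left h7 hc.le
      linarith [hlow x, hlow y]
    have h9 := mul_le_mul_of_nonneg_left h8 (by positivity : 0 ≤ s / 4)
    have h10 : 0 ≤ s * s * (ℓ x + ℓ y) := by
      have := hℓ0 x
      have := hℓ0 y
      positivity
    have h11 : τ * C1 ≤ C1 := mul_le_of_le_one_left hC10 hτ1.le
    rw [hCw, hρ₀]
    rw [hτs] at h6 h11 ⊢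
    linarith
  obtain ⟨x, y, p, hp, ⟨P, Z, hPZ⟩, ⟨Px, X, hPX⟩, ⟨Py, Y, hPY⟩, hmax⟩ :=
    good_point hε hg hk hτ hτ1 hρ (fun x y => (hW x y).trans (by gcongr))
  obtain ⟨hPx, hPy, hform⟩ := max_cond hτ hτ1 hPZ hPX hPY p hp hmax
  set z := (1 / 2 : ℝ) • (x + y) with hz
  -- bound on the maximum point
  obtain ⟨N, hN⟩ : ∃ N, N = ‖((x, y) : EuclideanSpace ℝ (Fin n) × EuclideanSpace ℝ (Fin n))‖ :=
    ⟨_, rfl⟩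
  have hpn : ∀ v : EuclideanSpace ℝ (Fin n) × EuclideanSpace ℝ (Fin n), |p v| ≤ ρ * ‖v‖ := by
    intro v
    have := p.le_opNorm v
    rw [Real.norm_eq_abs] at this
    exact this.trans (by gcongr)
  have hNR : N ≤ R := by
    have h1 := hmax 0 0
    have h2 := hW x y
    have h3 := (abs_le.1 (hpn (x, y))).1
    have h4 := hg.le 0
    have h5 := hk.le 0
    have e0 : ((0, 0) : EuclideanSpace ℝ (Fin n) × EuclideanSpace ℝ (Fin n)) = 0 := rfl
    rw [add_zero, smul_zero, e0, map_zero] at h1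
    simp only [Pi.neg_apply] at h5
    rw [← hN] at h2 h3
    rw [hR, le_div_iff₀ hρ₀0]
    have h6 := mul_le_mul_of_nonneg_left h4 hτ.le
    have h7 : s * u 0 ≤ s * |u 0| := mul_le_mul_of_nonneg_left (le_abs_self _) hs0.le
    have h8 : ρ * N ≤ ρ₀ * N := mul_le_mul_of_nonneg_right hρa (by rw [hN]; positivity)
    rw [hτs] at h6 h1 h2
    linarith
  have hxR : ‖x‖ ≤ R := le_trans (by rw [hN]; exact norm_fst_le (x, y)) hNR
  have hyR : ‖y‖ ≤ R := le_trans (by rw [hN]; exact norm_snd_le (x, y)) hNR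
  have hzR : ‖z‖ ≤ R := by
    rw [hz, norm_smul, Real.norm_of_nonneg (by norm_num)]
    have := norm_add_le x y
    linarith
  have hdz : |f (m z) - f z| < ω := hfr z _ hzR (by
    have h1 := hM1 ε hε hε1 g m hg z hzR
    refine lt_of_pow_lt_pow_left₀ 2 hr.le (lt_of_le_of_lt h1 (lt_of_le_of_lt ?_ hεa))
    exact mul_le_mul_of_nonneg_left (by linarith) hε.le)
  have hdx : |f (m' x) - f x| < ω := hfr x _ hxR (by
    have h1 := hM2 ε hε hε1 k m' hk x hxR
    refine lt_of_pow_lt_pow_left₀ 2 hr.le (lt_of_le_of_lt h1 (lt_of_le_of_lt ?_ hεa))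
    exact mul_le_mul_of_nonneg_left (by linarith) hε.le)
  have hdy : |f (m' y) - f y| < ω := hfr y _ hyR (by
    have h1 := hM2 ε hε hε1 k m' hk y hyR
    refine lt_of_pow_lt_pow_left₀ 2 hr.le (lt_of_le_of_lt h1 (lt_of_le_of_lt ?_ hεa))
    exact mul_le_mul_of_nonneg_left (by linarith) hε.le)
  -- value at the maximum
  have hval : κ / 4 ≤ τ * u (m z) - 1 / 2 * (u (m' x) + u (m' y)) := by
    have h1 := hmax x₀ y₀
    rw [← hz₀] at h1
    have h2 := (abs_le.1 (hpn (x, y))).1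
    have h3 := (abs_le.1 (hpn (x₀, y₀))).2
    rw [← hN] at h2
    rw [← hb] at h3
    have h4 := hg.le z₀
    have h5 := hk.le x₀
    have h6 := hk.le y₀
    simp only [Pi.neg_apply] at h5 h6
    have q : 0 ≤ 1 / (2 * ε) := by positivity
    have h7 : g z ≤ u (m z) := by
      rw [(hg z).1]; linarith [mul_nonneg q (sq_nonneg ‖z - m z‖)]
    have h8 : k x ≤ -u (m' x) := by
      rw [(hk x).1]; simp only [Pi.neg_apply]; linarith [mul_nonneg q (sq_nonneg ‖x - m' x‖)]
    have h9 : k y ≤ -u (m' y) := by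
      rw [(hk y).1]; simp only [Pi.neg_apply]; linarith [mul_nonneg q (sq_nonneg ‖y - m' y‖)]
    have h10 := mul_le_mul_of_nonneg_left h4 hτ.le
    have h11 := mul_le_mul_of_nonneg_left h7 hτ.le
    have h12 : s * u z₀ ≤ s * |u z₀| := mul_le_mul_of_nonneg_left (le_abs_self _) hs0.le
    have h13 : ρ * N ≤ ρ * R := mul_le_mul_of_nonneg_left hNR hρ.le
    have h14 : τ * u z₀ = u z₀ - s * u z₀ := by rw [hτs]; ring
    linarith
  have hS := sub_jet hsub (hg.jet hPZ hη)
  have key : ∀ (a Pa : EuclideanSpace ℝ (Fin n))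
      (Xa : EuclideanSpace ℝ (Fin n) →L[ℝ] EuclideanSpace ℝ (Fin n)), Twice k a Pa Xa →
      ‖τ • P + Pa‖ ≤ 2 * ρ →
      0 ≤ δ * u (m' a) + F (Mat (-(Xa + (2 * η) • ContinuousLinearMap.id ℝ _))) - f (m' a) := by
    intro a Pa Xa ha hn
    refine super_jet hsup (p := -Pa) ?_ ?_
    · filter_upwards [hk.jet ha hη] with w hw
      simp only [Pi.neg_apply] at hw
      rw [neg_apply, inner_neg_left, inner_neg_left]
      linarith
    · have := hρ₁H P hS.2 (-(τ • P + Pa)) (by rw [norm_neg]; linarith)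
      have e : τ • P + -(τ • P + Pa) = -Pa := by abel
      rwa [e] at this
  have hX := key x Px X hPX hPx
  have hY := key y Py Y hPY hPy
  have hF := F_key hθ hθΘ hFell hFhom hFsadd hτ hτ1 hη hform
  have hcv := hf.2 (Set.mem_univ x) (Set.mem_univ y) (by norm_num : (0:ℝ) ≤ 1 / 2)
    (by norm_num : (0:ℝ) ≤ 1 / 2) (by norm_num)
  rw [← smul_add, ← hz] at hcv
  simp only [smul_eq_mul] at hcv
  have b1 := (abs_lt.1 hdz).2
  have b2 := (abs_lt.1 hdx).1
  have b3 := (abs_lt.1 hdy).1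
  have b4 := mul_le_mul_of_nonneg_left hS.1 hτ.le
  have b5 := mul_le_mul_of_nonneg_left b1.le hτ.le
  have b6 : τ * ω ≤ ω := mul_le_of_le_one_left hω0.le hτ1.le
  have b7 := mul_le_mul_of_nonneg_left (hMf z) hs0.le
  have b8 := mul_le_mul_of_nonneg_left hval hδ.le
  have b9 : τ * f z = f z - s * f z := by rw [hτs]; ring
  have b10 : 0 < δ * κ := by positivity
  rw [zero_mul, zero_sub] at b7
  linarith

end Midconvex

open scoped RealInnerProductSpace
open Filter

section Final
variable {n : ℕ}

theorem convexOn_of_mid {u : EuclideanSpace ℝ (Fin n) → ℝ} (hu : Continuous u)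
    (hm : ∀ x y, u ((1 / 2 : ℝ) • (x + y)) ≤ 1 / 2 * (u x + u y)) : ConvexOn ℝ Set.univ u := by
  refine ⟨convex_univ, fun x _ y _ a b ha hb hab => ?_⟩
  set φ : ℝ → ℝ := fun t => u (x + t • (y - x)) - u x - t * (u y - u x) with hφ
  have hφc : Continuous φ := by fun_prop
  have hφm : ∀ s t, φ ((s + t) / 2) ≤ 1 / 2 * (φ s + φ t) := by
    intro s t
    have h := hm (x + s • (y - x)) (x + t • (y - x))
    have e : (1 / 2 : ℝ) • (x + s • (y - x) + (x + t • (y - x))) = x + ((s + t) / 2) • (y - x) := by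
      module
    rw [e] at h
    simp only [hφ]
    linarith
  have h0 : φ 0 = 0 := by simp [hφ]
  have h1 : φ 1 = 0 := by simp [hφ]
  have hb1 : b ≤ 1 := by linarith
  suffices hs : φ b ≤ 0 by
    have e : a • x + b • y = x + b • (y - x) := by
      rw [show a = 1 - b by linarith]; module
    rw [e, smul_eq_mul, smul_eq_mul, show a = 1 - b by linarith]
    simp only [hφ] at hs
    linarith
  obtain ⟨t₁, ht₁, hmax⟩ := (isCompact_Icc (a := (0:ℝ)) (b := 1)).exists_isMaxOn
    ⟨0, by simp⟩ hφc.continuousOn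
  have hmax' : ∀ t, 0 ≤ t → t ≤ 1 → φ t ≤ φ t₁ := fun t h h' => hmax ⟨h, h'⟩
  by_contra hcon
  push Not at hcon
  have hM : 0 < φ t₁ := lt_of_lt_of_le hcon (hmax' b hb hb1)
  have hS : IsCompact (Set.Icc (0:ℝ) 1 ∩ {t | φ t = φ t₁}) :=
    isCompact_Icc.inter_right (isClosed_eq hφc continuous_const)
  obtain ⟨t₀, ⟨⟨ht0, ht1⟩, hteq⟩, hmin⟩ := hS.exists_isMinOn ⟨t₁, ht₁, rfl⟩ continuousOn_id
  simp only [Set.mem_ofPred_eq] at hteq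
  have hlt : ∀ t, 0 ≤ t → t < t₀ → φ t < φ t₁ := by
    intro t h h'
    refine lt_of_le_of_ne (hmax' t h (by linarith)) fun he => ?_
    have : t₀ ≤ t := hmin ⟨⟨h, by linarith⟩, he⟩
    linarith
  have hpos : 0 < t₀ := lt_of_le_of_ne ht0 fun h => by rw [← h] at hteq; linarith
  have hlt1 : t₀ < 1 := lt_of_le_of_ne ht1 fun h => by rw [h] at hteq; linarith
  obtain ⟨r, hr, hr1, hr2⟩ : ∃ r : ℝ, 0 < r ∧ r ≤ t₀ ∧ r ≤ 1 - t₀ :=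
    ⟨min t₀ (1 - t₀), lt_min hpos (by linarith), min_le_left _ _, min_le_right _ _⟩
  have k1 := hφm (t₀ - r) (t₀ + r)
  rw [show (t₀ - r + (t₀ + r)) / 2 = t₀ by ring] at k1
  have k2 := hlt (t₀ - r) (by linarith) (by linarith)
  have k3 := hmax' (t₀ + r) (by linarith) (by linarith)
  linarith

theorem subgrad_mem {H ℓ u : EuclideanSpace ℝ (Fin n) → ℝ}
    (hKcpt : IsCompact {p : EuclideanSpace ℝ (Fin n) | H p ≤ 0})
    (hHconv : ConvexOn ℝ Set.univ H)
    (hℓ : ∀ v, IsGreatest {r : ℝ | ∃ p, H p ≤ 0 ∧ ⟪p, v⟫ = r} (ℓ v))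
    {L : ℝ} (hℓ0 : ∀ x, 0 ≤ ℓ x) (hlip : ∀ w z, ℓ w ≤ ℓ z + L * ‖w - z‖)
    (hgb : ∀ a : ℝ, 0 < a → ∃ C, 0 ≤ C ∧ ∀ x, |u x - ℓ x| ≤ a * ℓ x + C)
    {x₀ q : EuclideanSpace ℝ (Fin n)} (hq : ∀ y, u x₀ + ⟪q, y - x₀⟫ ≤ u y) : H q ≤ 0 := by
  by_contra hcon
  have hK : Convex ℝ {p : EuclideanSpace ℝ (Fin n) | H p ≤ 0} := by
    simpa using hHconv.convex_le 0
  obtain ⟨T, c, hT1, hT2⟩ := geometric_hahn_banach_closed_point hK hKcpt.isClosed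
    (show q ∉ {p : EuclideanSpace ℝ (Fin n) | H p ≤ 0} from hcon)
  set v := (InnerProductSpace.toDual ℝ (EuclideanSpace ℝ (Fin n))).symm T with hv
  have hTv : ∀ p, T p = ⟪p, v⟫ := fun p => by
    rw [real_inner_comm, hv, InnerProductSpace.toDual_symm_apply]
  obtain ⟨⟨p, hp, hpv⟩, -⟩ := hℓ v
  have h1 := hT1 p hp
  rw [hTv, hpv] at h1
  rw [hTv] at hT2
  obtain ⟨g, hg⟩ : ∃ g, g = ⟪q, v⟫ - ℓ v := ⟨_, rfl⟩
  have hg0 : 0 < g := by linarith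
  have hlv := hℓ0 v
  obtain ⟨a, ha⟩ : ∃ a, a = g / (2 * (ℓ v + 1)) := ⟨_, rfl⟩
  have ha0 : 0 < a := by rw [ha]; positivity
  have hav : a * (ℓ v + 1) = g / 2 := by rw [ha]; field_simp
  obtain ⟨C, hC0, hC⟩ := hgb a ha0
  have hhom : ∀ t : ℝ, 0 ≤ t → ℓ (t • v) ≤ t * ℓ v := by
    intro t ht
    obtain ⟨⟨p', hp', hpv'⟩, -⟩ := hℓ (t • v)
    rw [← hpv', real_inner_smul_right]
    exact mul_le_mul_of_nonneg_left ((hℓ v).2 ⟨p', hp', rfl⟩) ht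
  obtain ⟨D, hD⟩ : ∃ D, D = (1 + a) * (L * ‖x₀‖) + C - u x₀ := ⟨_, rfl⟩
  have hall : ∀ t : ℝ, 0 ≤ t → t * (g / 2) ≤ D := by
    intro t ht
    have k1 := hq (x₀ + t • v)
    rw [add_sub_cancel_left, real_inner_smul_right] at k1
    have k2 := (abs_le.1 (hC (x₀ + t • v))).2
    have k3 := hlip (x₀ + t • v) (t • v)
    rw [add_sub_cancel_right] at k3
    have k4 := hhom t ht
    have k5 : (1 + a) * ℓ (x₀ + t • v) ≤ (1 + a) * (t * ℓ v + L * ‖x₀‖) :=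
      mul_le_mul_of_nonneg_left (by linarith) (by positivity)
    have k6 : t * (a * (ℓ v + 1)) = t * (g / 2) := by rw [hav]
    have k7 : 0 ≤ t * a := by positivity
    have k8 : t * g = t * (⟪q, v⟫ - ℓ v) := by rw [hg]
    rw [hD]
    linarith
  have := hall (2 * (|D| + 1) / g) (by positivity)
  have e : 2 * (|D| + 1) / g * (g / 2) = |D| + 1 := by field_simp
  rw [e] at this
  linarith [le_abs_self D]

theorem unif_upper {F : Matrix (Fin n) (Fin n) ℝ → ℝ} {H f : EuclideanSpace ℝ (Fin n) → ℝ}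
    (hf : ConvexOn ℝ Set.univ f)
    (hfsl : Tendsto (fun x => f x / ‖x‖) (cocompact (EuclideanSpace ℝ (Fin n))) atTop)
    {L : ℝ} (hL : 0 < L) (hHL : ∀ p, H p ≤ 0 → ‖p‖ ≤ L) :
    ∃ C₀ : ℝ, 0 ≤ C₀ ∧ ∀ δ : ℝ, 0 < δ → δ < 1 → ∀ u : EuclideanSpace ℝ (Fin n) → ℝ,
      Continuous u → IsSubsolutionDisc F H f δ u → (∀ x y, u x ≤ u y + L * ‖x - y‖) →
      ∀ x, δ * u x - f x ≤ C₀ := by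
  have hfc : Continuous f := hf.locallyLipschitz.continuous
  obtain ⟨M, hM0, hM⟩ := f_lower hf hfsl L
  obtain ⟨Mb, hMb⟩ := (isCompact_closedBall (0 : EuclideanSpace ℝ (Fin n)) L).exists_bound_of_continuousOn
    hfc.continuousOn
  set F2 := F (Mat ((2 : ℝ) • ContinuousLinearMap.id ℝ (EuclideanSpace ℝ (Fin n)))) with hF2
  refine ⟨max 0 (Mb - F2 + L * L + M), le_max_left _ _, fun δ hδ hδ1 u hu hsub hlip x => ?_⟩
  refine le_trans ?_ (le_max_right _ _)
  have hcont : Continuous (fun x => u x - ‖x‖ ^ 2) := by fun_prop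
  obtain ⟨z, hz⟩ := hcont.exists_forall_ge' 0 (by
    filter_upwards [ev_cocompact (0 : EuclideanSpace ℝ (Fin n)) L] with y hy
    have h1 := hlip y 0
    rw [sub_zero] at hy h1
    have h2 : L * ‖y‖ ≤ ‖y‖ * ‖y‖ := mul_le_mul_of_nonneg_right hy.le (norm_nonneg _)
    simp only [norm_zero]
    linarith)
  obtain ⟨s1, s2⟩ := sub_jet hsub (x₀ := z) (p := (2 : ℝ) • z)
    (B := (2 : ℝ) • ContinuousLinearMap.id ℝ (EuclideanSpace ℝ (Fin n))) (by
      refine Eventually.of_forall fun y => ?_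
      have h1 := hz y
      have h2 : ‖y‖ ^ 2 = ‖z‖ ^ 2 + 2 * ⟪z, y - z⟫ + ‖y - z‖ ^ 2 := by
        rw [← norm_add_sq_real, add_sub_cancel]
      simp only [smul_apply, ContinuousLinearMap.id_apply, real_inner_smul_left,
        real_inner_self_eq_norm_sq]
      linarith)
  have hzn := hHL _ s2
  rw [norm_smul, Real.norm_of_nonneg (by norm_num)] at hzn
  have hzL : ‖z‖ ≤ L := by linarith [norm_nonneg z]
  have hfz := hMb z (by simpa using hzL)
  rw [Real.norm_eq_abs] at hfz
  have h3 := (abs_le.1 hfz).2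
  have h4 := mul_le_mul_of_nonneg_left (hlip x z) hδ.le
  have h5 : L * ‖x - z‖ ≤ L * (‖x‖ + L) :=
    mul_le_mul_of_nonneg_left ((norm_sub_le x z).trans (by linarith)) hL.le
  have h6 : δ * (L * ‖x - z‖) ≤ L * ‖x - z‖ := mul_le_of_le_one_left (by positivity) hδ1.le
  have h7 := hM x
  linarith

theorem doubling {D : EuclideanSpace ℝ (Fin n) → ℝ} {C L : ℝ} (hC : 0 < C)
    (hD : ∀ v, D v ≤ 2 * L * ‖v‖) {h : EuclideanSpace ℝ (Fin n)} (h0 : h ≠ 0)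
    (hh : C * ‖h‖ ^ 2 < D h) : ∃ k, C * ‖k‖ ^ 2 < D k ∧ D ((2 : ℝ) • k) ≤ 4 * D k := by
  by_contra hcon
  push Not at hcon
  have hk : ∀ k : ℕ, C * ‖((2 : ℝ) ^ k) • h‖ ^ 2 < D (((2 : ℝ) ^ k) • h) := by
    intro k
    induction k with
    | zero => simpa using hh
    | succ k ih =>
      have h1 := hcon _ ih
      have e : ((2 : ℝ) ^ (k + 1)) • h = (2 : ℝ) • ((2 : ℝ) ^ k) • h := by
        rw [smul_smul, pow_succ, mul_comm]
      rw [e, norm_smul, Real.norm_of_nonneg (by norm_num : (0:ℝ) ≤ 2)]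
      linarith
  have hhn : 0 < ‖h‖ := norm_pos_iff.2 h0
  obtain ⟨k, hk2⟩ := pow_unbounded_of_one_lt (2 * L / (C * ‖h‖)) (by norm_num : (1:ℝ) < 2)
  rw [div_lt_iff₀ (by positivity)] at hk2
  have h1 := (hk k).trans_le (hD _)
  rw [norm_smul, Real.norm_of_nonneg (by positivity)] at h1
  have h2 : 0 < (2:ℝ) ^ k * ‖h‖ := by positivity
  have h3 := mul_lt_mul_of_pos_right hk2 h2
  linarith

theorem F_test {θ Θ : ℝ} {F : Matrix (Fin n) (Fin n) ℝ → ℝ}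
    (hFell : ∀ M N : Matrix (Fin n) (Fin n) ℝ, M.IsSymm → N.PosSemidef →
      -Θ * N.trace ≤ F (M + N) - F M ∧ F (M + N) - F M ≤ -θ * N.trace)
    (hFhom : ∀ t : ℝ, 0 ≤ t → ∀ M : Matrix (Fin n) (Fin n) ℝ, M.IsSymm →
      F (t • M) = t * F M) {a ε : ℝ} (ha : 0 ≤ a) (hε : 0 ≤ ε) (d : EuclideanSpace ℝ (Fin n)) :
    F (Mat (a • (innerSL ℝ d).smulRight d - ε • ContinuousLinearMap.id ℝ _)) ≤
      -θ * (a * ‖d‖ ^ 2) + Θ * n * ε := by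
  have F0 : F 0 = 0 := by
    have := hFhom 0 le_rfl 0 Matrix.isSymm_zero
    simpa using this
  set B := a • (innerSL ℝ d).smulRight d - ε • ContinuousLinearMap.id ℝ (EuclideanSpace ℝ (Fin n))
    with hB
  have h1 := (hFell 0 (Mat (a • (innerSL ℝ d).smulRight d)) Matrix.isSymm_zero (Mat_psd _ fun v => by
    simp only [smul_apply, ContinuousLinearMap.smulRight_apply, innerSL_apply_apply,
      real_inner_smul_left]
    have := mul_self_nonneg ⟪d, v⟫
    positivity)).2
  have h2 := (hFell (Mat B) (Mat (ε • ContinuousLinearMap.id ℝ _)) (Mat_symm _) (Mat_psd _ fun v => by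
    simp only [smul_apply, ContinuousLinearMap.id_apply, real_inner_smul_left,
      real_inner_self_eq_norm_sq]
    positivity)).1
  rw [← Mat_add, hB, sub_add_cancel, ← hB, Mat_smul ε, Matrix.trace_smul, Mat_id_trace] at h2
  rw [zero_add, F0, Mat_smul, Matrix.trace_smul, Mat_rank1_trace, ← Mat_smul] at h1
  simp only [smul_eq_mul] at h1 h2
  linarith

theorem H_comb {H : EuclideanSpace ℝ (Fin n) → ℝ} {σ : ℝ} (hσ : 0 < σ)
    (hHsc : ConvexOn ℝ Set.univ fun p => H p - σ / 2 * ‖p‖ ^ 2)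
    {p q : EuclideanSpace ℝ (Fin n)} (hp : H p ≤ 0) (hq : H q ≤ 0) (hd : p - q ≠ 0)
    {t : ℝ} (ht : |t| ≤ 1 / 4) : H ((1 / 2 : ℝ) • (p + q) + t • (p - q)) < 0 := by
  obtain ⟨h1, h2⟩ := abs_le.1 ht
  have ha : 0 < 1 / 2 + t := by linarith
  have hb : 0 < 1 / 2 - t := by linarith
  have h := hHsc.2 (Set.mem_univ p) (Set.mem_univ q) ha.le hb.le (by ring)
  have e : (1 / 2 : ℝ) • (p + q) + t • (p - q) = (1 / 2 + t) • p + (1 / 2 - t) • q := by module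
  rw [e]
  simp only [smul_eq_mul] at h
  have h3 : ‖(1 / 2 + t) • p + (1 / 2 - t) • q‖ ^ 2 =
      (1 / 2 + t) * ‖p‖ ^ 2 + (1 / 2 - t) * ‖q‖ ^ 2 -
        (1 / 2 + t) * (1 / 2 - t) * ‖p - q‖ ^ 2 := by
    rw [norm_add_sq_real, norm_sub_sq_real, norm_smul, norm_smul, real_inner_smul_left,
      real_inner_smul_right, Real.norm_of_nonneg ha.le, Real.norm_of_nonneg hb.le]
    ring
  rw [h3] at h
  have hd' : 0 < ‖p - q‖ := norm_pos_iff.2 hd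
  have h4 : 0 < σ * ((1 / 2 + t) * (1 / 2 - t) * ‖p - q‖ ^ 2) := by positivity
  have h5 := mul_nonneg ha.le (neg_nonneg.2 hp)
  have h6 := mul_nonneg hb.le (neg_nonneg.2 hq)
  linarith

set_option maxHeartbeats 1000000 in
theorem local_bound {θ Θ : ℝ} (hθ : 0 < θ) (hθΘ : θ ≤ Θ) {F : Matrix (Fin n) (Fin n) ℝ → ℝ}
    (hFell : ∀ M N : Matrix (Fin n) (Fin n) ℝ, M.IsSymm → N.PosSemidef →
      -Θ * N.trace ≤ F (M + N) - F M ∧ F (M + N) - F M ≤ -θ * N.trace)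
    (hFhom : ∀ t : ℝ, 0 ≤ t → ∀ M : Matrix (Fin n) (Fin n) ℝ, M.IsSymm →
      F (t • M) = t * F M)
    {H f : EuclideanSpace ℝ (Fin n) → ℝ} (hH : Continuous H) {σ : ℝ} (hσ : 0 < σ)
    (hHsc : ConvexOn ℝ Set.univ fun p => H p - σ / 2 * ‖p‖ ^ 2)
    {δ : ℝ} {u : EuclideanSpace ℝ (Fin n) → ℝ} (hu : Continuous u)
    (hsup : IsSupersolutionDisc F H f δ u) {C₀ C : ℝ} (hC : 0 < C)
    (hC0 : ∀ x, δ * u x - f x ≤ C₀) (hCC : 32 * C₀ < θ * C)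
    {x₀ h qp qm : EuclideanSpace ℝ (Fin n)}
    (hqp : ∀ y, u (x₀ + h) + ⟪qp, y - (x₀ + h)⟫ ≤ u y)
    (hqm : ∀ y, u (x₀ - h) + ⟪qm, y - (x₀ - h)⟫ ≤ u y)
    (hHp : H qp ≤ 0) (hHm : H qm ≤ 0)
    (h1 : C * ‖h‖ ^ 2 < u (x₀ + h) - 2 * u x₀ + u (x₀ - h))
    (h2 : u (x₀ + (2 : ℝ) • h) - 2 * u x₀ + u (x₀ - (2 : ℝ) • h) ≤
      4 * (u (x₀ + h) - 2 * u x₀ + u (x₀ - h))) : False := by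
  have hΘ : 0 < Θ := hθ.trans_le hθΘ
  obtain ⟨D, hD⟩ : ∃ D, D = u (x₀ + h) - 2 * u x₀ + u (x₀ - h) := ⟨_, rfl⟩
  have hD0 : 0 < D := by rw [hD]; exact lt_of_le_of_lt (by positivity) h1
  set d := qp - qm with hd
  have e1 : D ≤ ⟪d, h⟫ := by
    have a1 := hqp x₀
    have a2 := hqm x₀
    rw [show x₀ - (x₀ + h) = -h by abel, inner_neg_right] at a1
    rw [show x₀ - (x₀ - h) = h by abel] at a2
    rw [hd, inner_sub_left]; linarith
  have e2 : ⟪d, h⟫ ≤ 3 * D := by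
    have a1 := hqp (x₀ + (2 : ℝ) • h)
    have a2 := hqm (x₀ - (2 : ℝ) • h)
    rw [show x₀ + (2 : ℝ) • h - (x₀ + h) = h by module] at a1
    rw [show x₀ - (2 : ℝ) • h - (x₀ - h) = -h by module, inner_neg_right] at a2
    rw [hd, inner_sub_left]; linarith
  have hd0 : d ≠ 0 := by
    intro h0
    rw [h0, inner_zero_left] at e1
    linarith
  have hdn : 0 < ‖d‖ := norm_pos_iff.2 hd0
  obtain ⟨μ, hμ⟩ : ∃ μ, μ = ‖d‖ ^ 2 / C := ⟨_, rfl⟩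
  have hμ0 : 0 < μ := by rw [hμ]; positivity
  have hμC : μ * C = ‖d‖ ^ 2 := by rw [hμ]; field_simp
  have hDμ : D < μ := by
    have a1 : D ≤ ‖d‖ * ‖h‖ := e1.trans (real_inner_le_norm _ _)
    have a2 : D * D ≤ (‖d‖ * ‖h‖) * (‖d‖ * ‖h‖) := mul_self_le_mul_self hD0.le a1
    rw [← hD] at h1
    have a3 : C * (D * D) ≤ ‖d‖ ^ 2 * (C * ‖h‖ ^ 2) := by
      have := mul_le_mul_of_nonneg_left a2 hC.le
      linarith
    have a4 : ‖d‖ ^ 2 * (C * ‖h‖ ^ 2) < ‖d‖ ^ 2 * D := mul_lt_mul_of_pos_left h1 (by positivity)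
    rw [← hμC] at a4
    have a5 : (C * D) * D < (C * D) * μ := by rw [← hμC] at a3; linarith
    exact lt_of_mul_lt_mul_left a5 (by positivity)
  -- the functions
  set s : EuclideanSpace ℝ (Fin n) → ℝ := fun x =>
    (u (x₀ + h) + ⟪qp, x - (x₀ + h)⟫) - (u (x₀ - h) + ⟪qm, x - (x₀ - h)⟫) with hs
  set ut : EuclideanSpace ℝ (Fin n) → ℝ := fun x => u x -
    1 / 2 * ((u (x₀ + h) + ⟪qp, x - (x₀ + h)⟫) + (u (x₀ - h) + ⟪qm, x - (x₀ - h)⟫)) with hut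
  have hsc : Continuous s := by fun_prop
  have hutc : Continuous ut := by fun_prop
  have hus : ∀ x, 1 / 2 * |s x| ≤ ut x := by
    intro x
    have a1 := hqp x
    have a2 := hqm x
    rcases abs_cases (s x) with ⟨e, -⟩ | ⟨e, -⟩ <;> rw [e] <;> simp only [hs, hut] <;> linarith
  have hut0 : ut x₀ ≤ D := by
    simp only [hut]
    rw [show x₀ - (x₀ + h) = -h by abel, inner_neg_right, show x₀ - (x₀ - h) = h by abel]
    rw [hd, inner_sub_left] at e2
    linarith
  -- small parameter
  have hSc : IsCompact ((fun t : ℝ => (1 / 2 : ℝ) • (qp + qm) + t • (qp - qm)) ''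
      Set.Icc (-(1 / 4)) (1 / 4)) := isCompact_Icc.image (by fun_prop)
  obtain ⟨ρ, hρ, hρH⟩ := thick hH hSc (by
    rintro _ ⟨t, ht, rfl⟩
    exact H_comb hσ hHsc hHp hHm hd0 (abs_le.2 ht))
  obtain ⟨ε, hε, hε1, hε2⟩ : ∃ ε : ℝ, 0 < ε ∧ 2 * μ * ε ≤ ρ ^ 2 ∧ Θ * n * ε ≤ θ * C / 32 := by
    refine ⟨min (ρ ^ 2 / (2 * μ)) (θ * C / (32 * (Θ * n + 1))), by positivity, ?_, ?_⟩
    · calc _ ≤ 2 * μ * (ρ ^ 2 / (2 * μ)) :=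
            mul_le_mul_of_nonneg_left (min_le_left _ _) (by positivity)
        _ = ρ ^ 2 := by field_simp
    · calc _ ≤ Θ * n * (θ * C / (32 * (Θ * n + 1))) :=
            mul_le_mul_of_nonneg_left (min_le_right _ _) (by positivity)
        _ ≤ (Θ * n + 1) * (θ * C / (32 * (Θ * n + 1))) :=
            mul_le_mul_of_nonneg_right (by linarith) (by positivity)
        _ = θ * C / 32 := by field_simp
  obtain ⟨R, hR⟩ : ∃ R, R = Real.sqrt (2 * μ / ε) := ⟨_, rfl⟩
  have hR0 : 0 ≤ R := by rw [hR]; positivity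
  have hR2 : R ^ 2 = 2 * μ / ε := by rw [hR, Real.sq_sqrt (by positivity)]
  have hR3 : ε * R ^ 2 = 2 * μ := by rw [hR2]; field_simp
  set ψ : EuclideanSpace ℝ (Fin n) → ℝ := fun x =>
    ut x - 1 / (32 * μ) * s x ^ 2 + ε / 2 * ‖x - x₀‖ ^ 2 with hψ
  have hψc : Continuous ψ := by fun_prop
  have hψ0 : ψ x₀ < μ := by
    simp only [hψ, sub_self, norm_zero]
    have : 0 ≤ 1 / (32 * μ) * s x₀ ^ 2 := by positivity
    linarith
  have hs0 : |s x₀| < 4 * μ := by have := hus x₀; linarith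
  have hS : IsCompact (Metric.closedBall x₀ R ∩ {x | |s x| ≤ 4 * μ}) :=
    (isCompact_closedBall _ _).inter_right (isClosed_le (by fun_prop) continuous_const)
  obtain ⟨z, ⟨hzR, hzs⟩, hmin⟩ := hS.exists_isMinOn ⟨x₀, by simpa using hR0, hs0.le⟩ hψc.continuousOn
  have hψz : ψ z < μ := lt_of_le_of_lt (hmin ⟨by simpa using hR0, hs0.le⟩) hψ0
  rw [Set.mem_ofPred_eq] at hzs
  have hsq : s z ^ 2 = |s z| * |s z| := by rw [← sq, sq_abs]
  have hq1 : 1 / (32 * μ) * s z ^ 2 = |s z| * (|s z| / (32 * μ)) := by rw [hsq]; ring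
  have hq2 : |s z| / (32 * μ) ≤ 1 / 8 := by rw [div_le_iff₀ (by positivity)]; linarith
  have hq3 : |s z| * (|s z| / (32 * μ)) ≤ |s z| * (1 / 8) :=
    mul_le_mul_of_nonneg_left hq2 (abs_nonneg _)
  have hlow : 3 / 8 * |s z| + ε / 2 * ‖z - x₀‖ ^ 2 < μ := by
    have := hus z
    simp only [hψ] at hψz
    linarith
  have hεz : 0 ≤ ε / 2 * ‖z - x₀‖ ^ 2 := by positivity
  have hzs' : |s z| < 4 * μ := by linarith
  have hzR2 : ε * ‖z - x₀‖ ^ 2 < 2 * μ := by linarith [abs_nonneg (s z)]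
  have hzR' : ‖z - x₀‖ < R := by
    refine lt_of_pow_lt_pow_left₀ 2 hR0 (lt_of_mul_lt_mul_left ?_ hε.le)
    rw [hR3]; exact hzR2
  have hev : ∀ᶠ x in nhds z, ψ z ≤ ψ x := by
    have o1 : ∀ᶠ x in nhds z, |s x| < 4 * μ :=
      (by fun_prop : Continuous fun x => |s x|).continuousAt.eventually_lt continuousAt_const hzs'
    have o2 : ∀ᶠ x in nhds z, ‖x - x₀‖ < R :=
      (by fun_prop : Continuous fun x => ‖x - x₀‖).continuousAt.eventually_lt continuousAt_const hzR'
    filter_upwards [o1, o2] with x a1 a2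
    exact hmin ⟨by rw [mem_closedBall_iff_norm]; exact a2.le, a1.le⟩
  obtain ⟨t, ht⟩ : ∃ t, t = s z / (16 * μ) := ⟨_, rfl⟩
  have ht4 : |t| ≤ 1 / 4 := by
    rw [ht, abs_div, abs_of_pos (by positivity : 0 < 16 * μ), div_le_iff₀ (by positivity)]
    linarith
  have hsmall : ‖-(ε • (z - x₀))‖ ≤ ρ := by
    rw [norm_neg, norm_smul, Real.norm_of_nonneg hε.le]
    refine (sq_le_sq₀ (by positivity) hρ.le).1 ?_
    have := mul_le_mul_of_nonneg_left hzR2.le hε.le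
    linarith
  have hHneg := hρH _ ⟨t, abs_le.1 ht4, rfl⟩ _ hsmall
  have hJ := super_jet hsup (x₀ := z)
    (B := (1 / (16 * μ)) • (innerSL ℝ d).smulRight d - ε • ContinuousLinearMap.id ℝ _) (by
      filter_upwards [hev] with x hx
      have a1 : s x = s z + ⟪d, x - z⟫ := by
        simp only [hs, hd, inner_sub_left, inner_sub_right, inner_add_right]; ring
      have a2 : ut x - ut z = u x - u z - 1 / 2 * ⟪qp + qm, x - z⟫ := by
        simp only [hut, inner_sub_right, inner_add_right, inner_add_left]; ring
      have a3 : ‖x - x₀‖ ^ 2 = ‖z - x₀‖ ^ 2 + 2 * ⟪z - x₀, x - z⟫ + ‖x - z‖ ^ 2 := by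
        rw [← norm_add_sq_real, show z - x₀ + (x - z) = x - x₀ by abel]
      have a4 : 1 / (32 * μ) * s x ^ 2 = 1 / (32 * μ) * s z ^ 2 + t * ⟪d, x - z⟫ +
          1 / 2 * (1 / (16 * μ) * (⟪d, x - z⟫ * ⟪d, x - z⟫)) := by
        rw [a1, ht]; field_simp; ring
      have a5 : ‖x - z‖ ^ 2 = ⟪x, x - z⟫ - ⟪z, x - z⟫ := by
        rw [← inner_sub_left, real_inner_self_eq_norm_sq]
      simp only [hψ] at hx
      rw [a3, a4, a5] at hx
      simp only [inner_add_left, inner_neg_left, real_inner_smul_left, sub_apply, inner_sub_left,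
        smul_apply, ContinuousLinearMap.smulRight_apply, innerSL_apply_apply,
        ContinuousLinearMap.id_apply] at hx a2 ⊢
      simp only [hd, inner_sub_left] at hx a2 ⊢
      linarith) hHneg
  have hFt := F_test hFell hFhom (a := 1 / (16 * μ)) (by positivity) hε.le d
  have e5 : 1 / (16 * μ) * ‖d‖ ^ 2 = C / 16 := by rw [← hμC]; field_simp
  rw [e5] at hFt
  have := hC0 z
  linarith

end Final

/-- If `F` is uniformly elliptic and `H` is uniformly convex, then there is a
constant `C`, independent of `δ ∈ (0,1)`, with
`0 ≤ u_δ(x+h) - 2u_δ(x) + u_δ(x-h) ≤ C|h|²` for all `x, h`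
(i.e. `D²u_δ ∈ L^∞` uniformly in `δ`). -/
theorem uniform_second_derivative_bound
    {n : ℕ} (hn : 0 < n)
    (θ Θ : ℝ) (hθ : 0 < θ) (hθΘ : θ ≤ Θ)
    (F : Matrix (Fin n) (Fin n) ℝ → ℝ)
    (hFell : ∀ M N : Matrix (Fin n) (Fin n) ℝ, M.IsSymm → N.PosSemidef →
      -Θ * N.trace ≤ F (M + N) - F M ∧ F (M + N) - F M ≤ -θ * N.trace)
    (hFhom : ∀ t : ℝ, 0 ≤ t → ∀ M : Matrix (Fin n) (Fin n) ℝ, M.IsSymm →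
      F (t • M) = t * F M)
    (hFsadd : ∀ M N : Matrix (Fin n) (Fin n) ℝ, M.IsSymm → N.IsSymm →
      F M + F N ≤ F (M + N))
    (H ℓ : EuclideanSpace ℝ (Fin n) → ℝ)
    (hH : Continuous H) (hH0 : H 0 < 0)
    (hKcpt : IsCompact {p : EuclideanSpace ℝ (Fin n) | H p ≤ 0})
    (hKconv : StrictConvex ℝ {p : EuclideanSpace ℝ (Fin n) | H p ≤ 0})
    (hHconv : ConvexOn ℝ Set.univ H)
    (σ Sig : ℝ) (hσ : 0 < σ) (hSig : 0 < Sig)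
    (hHsc : ConvexOn ℝ Set.univ fun p => H p - σ / 2 * ‖p‖ ^ 2)
    (hHSc : ConvexOn ℝ Set.univ fun p => Sig / 2 * ‖p‖ ^ 2 - H p)
    (hℓ : ∀ v, IsGreatest {r : ℝ | ∃ p, H p ≤ 0 ∧ ⟪p, v⟫ = r} (ℓ v))
    (f : EuclideanSpace ℝ (Fin n) → ℝ)
    (hf : ConvexOn ℝ Set.univ f)
    (hfsl : Tendsto (fun x => f x / ‖x‖) (cocompact (EuclideanSpace ℝ (Fin n))) atTop) :
    ∃ C : ℝ, ∀ δ ∈ Set.Ioo (0 : ℝ) 1,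
      ∀ u : EuclideanSpace ℝ (Fin n) → ℝ, Continuous u →
        IsSubsolutionDisc F H f δ u → IsSupersolutionDisc F H f δ u →
        Tendsto (fun x => u x / ℓ x) (cocompact (EuclideanSpace ℝ (Fin n))) (nhds 1) →
        ∀ x h : EuclideanSpace ℝ (Fin n),
          0 ≤ u (x + h) - 2 * u x + u (x - h) ∧
          u (x + h) - 2 * u x + u (x - h) ≤ C * ‖h‖ ^ 2 := by
  obtain ⟨c, L, hc, hL, hlow, hup, hlip, -, hHL⟩ := ell_facts hH hH0 hKcpt hℓ
  have hℓ0 : ∀ x, 0 ≤ ℓ x := fun x => le_trans (by positivity) (hlow x)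
  obtain ⟨C₀, hC₀, hub⟩ := unif_upper (F := F) hf hfsl hL hHL
  obtain ⟨C, hC⟩ : ∃ C, C = 32 * C₀ / θ + 1 := ⟨_, rfl⟩
  have hCpos : 0 < C := by rw [hC]; positivity
  have hCC : 32 * C₀ < θ * C := by
    have : θ * C = 32 * C₀ + θ := by rw [hC]; field_simp
    linarith
  refine ⟨C, fun δ hδ u hu hsub hsup hgr x h => ?_⟩
  have hmid := midconvex θ Θ hθ hθΘ F hFell hFhom hFsadd H ℓ hH hH0 hKcpt hHconv hℓ f hf hfsl
    δ hδ.1 u hu hsub hsup hgr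
  constructor
  · have := hmid (x + h) (x - h)
    rw [show (1 / 2 : ℝ) • (x + h + (x - h)) = x by module] at this
    linarith
  have hcv := convexOn_of_mid hu hmid
  have hmem : ∀ y q, (∀ w, u y + ⟪q, w - y⟫ ≤ u w) → H q ≤ 0 := fun y q hq =>
    subgrad_mem hKcpt hHconv hℓ hℓ0 hlip
      (fun a ha => growth_bound hc hlow hlip hu hgr ha) hq
  have hulip : ∀ y w, u y ≤ u w + L * ‖y - w‖ := by
    intro y w
    obtain ⟨q, hq⟩ := exists_subgrad hcv y
    have h1 := hq w
    have h2 := hHL q (hmem y q hq)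
    have h3 := (abs_le.1 (abs_real_inner_le_norm q (w - y))).1
    have h4 : ‖q‖ * ‖w - y‖ ≤ L * ‖y - w‖ := by
      rw [norm_sub_rev w y]
      exact mul_le_mul_of_nonneg_right h2 (norm_nonneg _)
    linarith
  have hb := hub δ hδ.1 hδ.2 u hu hsub hulip
  by_contra hcon
  push Not at hcon
  have hh0 : h ≠ 0 := by
    rintro rfl
    simp at hcon
    linarith
  obtain ⟨k, hk1, hk2⟩ := doubling (D := fun v => u (x + v) - 2 * u x + u (x - v)) (L := L) hCpos
    (fun v => by
      have h1 := hulip (x + v) x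
      have h2 := hulip (x - v) x
      rw [add_sub_cancel_left] at h1
      rw [sub_sub_cancel_left, norm_neg] at h2
      linarith) hh0 hcon
  obtain ⟨qp, hqp⟩ := exists_subgrad hcv (x + k)
  obtain ⟨qm, hqm⟩ := exists_subgrad hcv (x - k)
  exact local_bound hθ hθΘ hFell hFhom hH hσ hHsc hu hsup hCpos hb hCC hqp hqm
    (hmem _ _ hqp) (hmem _ _ hqm) hk1 hk2
end
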